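/- arXiv:1711.05398 — 8 statements merged into one kernel-verified Lean document; each statement's English description precedes it below -/
import Mathlib

section
/- If G is a finite 2-connected cubic graph (equivalently, since connectivity and edge-connectivity coincide for cubic graphs, a 2-edge-connected cubic graph), then the anti-Kekulé number of G satisfies 3 ≤ ak(G) ≤ 4; that is, G has an anti-Kekulé set with at most 4 edges, and every anti-Kekulé set of G has at least 3 edges. -/
open SimpleGraph

/-- An edge set `S` of a graph `G` is an anti-Kekulé set if `S` consists of edges of `G`,
`G - S` is connected, and `G - S` has no perfect matching. -/
def IsAntiKekuleSet {V : Type*} (G : SimpleGraph V) (S : Finset (Sym2 V)) : Prop :=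
  ↑S ⊆ G.edgeSet ∧ (G.deleteEdges ↑S).Connected ∧
    ¬ ∃ M : (G.deleteEdges ↑S).Subgraph, M.IsPerfectMatching

namespace SimpleGraph

variable {V : Type*} [Fintype V] {G : SimpleGraph V} [DecidableRel G.Adj]

lemma even_card_of_cubic (hcubic : ∀ v : V, G.degree v = 3) : Even (Nat.card V) := by
  have h := G.sum_degrees_eq_twice_card_edges
  simp only [hcubic, Finset.sum_const, Finset.card_univ, smul_eq_mul] at h
  rw [Nat.card_eq_fintype_card, Nat.even_iff]
  omega

variable [DecidableEq V]

/-- The darts of `G` leaving the vertex set `X`. -/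
def dartBoundary (G : SimpleGraph V) [DecidableRel G.Adj] (X : Finset V) : Finset (V × V) :=
  G.interedges X Xᶜ

lemma mem_dartBoundary {X : Finset V} {u w : V} :
    (u, w) ∈ G.dartBoundary X ↔ u ∈ X ∧ w ∉ X ∧ G.Adj u w := by
  simp [dartBoundary, mk_mem_interedges_iff]

lemma two_le_card_dartBoundary (hconn : G.Connected)
    (hbridgeless : ∀ e ∈ G.edgeSet, ¬ G.IsBridge e) {X : Finset V} (hne : X.Nonempty)
    {z : V} (hz : z ∉ X) : 2 ≤ (G.dartBoundary X).card := by
  obtain ⟨x, hx⟩ := hne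
  obtain ⟨p⟩ := hconn.preconnected x z
  obtain ⟨d, -, hd1, hd2⟩ := p.exists_boundary_dart (X : Set V) (by simpa using hx)
    (by simpa using hz)
  have hnb := hbridgeless s(d.fst, d.snd) d.adj
  rw [isBridge_iff, not_not] at hnb
  obtain ⟨q⟩ := hnb
  obtain ⟨e, -, he1, he2⟩ := q.exists_boundary_dart (X : Set V) hd1 hd2
  have hadj := e.adj
  rw [deleteEdges_adj] at hadj
  have hde : ((d.fst, d.snd) : V × V) ≠ (e.fst, e.snd) := by
    intro h
    rw [Prod.mk.injEq] at h
    exact hadj.2 (by simp [h.1, h.2])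
  rw [← Finset.card_pair hde]
  refine Finset.card_le_card ?_
  simp only [Finset.insert_subset_iff, Finset.singleton_subset_iff, mem_dartBoundary]
  exact ⟨⟨by simpa using hd1, by simpa using hd2, d.adj⟩,
    ⟨by simpa using he1, by simpa using he2, hadj.1⟩⟩

lemma odd_card_dartBoundary (hcubic : ∀ v : V, G.degree v = 3) {X : Finset V} (hX : Odd X.card) :
    Odd (G.dartBoundary X).card := by
  have hsplit : ∀ Y : Finset V,
      (G.interedges X Y).card = ∑ u ∈ X, (G.neighborFinset u ∩ Y).card := by
    intro Y
    rw [interedges_def, Finset.card_filter, Finset.sum_product]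
    refine Finset.sum_congr rfl fun u _ => ?_
    rw [← Finset.card_filter]
    congr 1
    ext w
    simp [and_comm]
  have hsum : (G.interedges X X).card + (G.dartBoundary X).card = 3 * X.card := by
    rw [dartBoundary, hsplit, hsplit, ← Finset.sum_add_distrib, mul_comm, ← smul_eq_mul,
      ← Finset.sum_const]
    refine Finset.sum_congr rfl fun u _ => ?_
    rw [← hcubic u, ← card_neighborFinset_eq_degree, ← Finset.sdiff_eq_inter_compl]
    exact Finset.card_inter_add_card_sdiff _ _
  have heven : Even (G.interedges X X).card := by
    classical
    have h := sum_degrees_eq_twice_card_edges (G.induce (X : Set V))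
    have h2 : (G.interedges X X).card = ∑ v, (G.induce (X : Set V)).degree v := by
      rw [hsplit, ← Finset.sum_coe_sort]
      refine Finset.sum_congr rfl fun u _ => ?_
      rw [← card_neighborFinset_eq_degree]
      refine (Finset.card_bij (fun (w : (X : Set V)) _ => (w : V)) ?_ ?_ ?_).symm
      · intro w hw
        simpa using hw
      · intro w _ w' _ h
        exact Subtype.ext h
      · intro w hw
        rw [Finset.mem_inter] at hw
        exact ⟨⟨w, hw.2⟩, by simpa using hw.1, rfl⟩
    rw [h2, h]
    exact even_two_mul _
  have : Odd (3 * X.card) := by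
    rw [Nat.odd_mul]
    exact ⟨by decide, hX⟩
  rw [← hsum, Nat.odd_add] at this
  by_contra hc
  rw [Nat.not_odd_iff_even] at hc
  exact Nat.not_odd_iff_even.mpr heven (this.mpr hc)

lemma eq_empty_of_closed_off_pair (hcubic : ∀ v : V, G.degree v = 3) {X : Finset V}
    (hX : ∀ Y ⊂ X, Y.Nonempty → 3 ≤ (G.dartBoundary Y).card) {v a b : V} (hab : a ≠ b)
    (hva : G.Adj v a) (hvb : G.Adj v b) {D : Finset V} (hvD : v ∉ D)
    (hD : ∀ u ∈ D, ∀ w, G.Adj u w → w ∈ D ∨ w = a ∨ w = b) (haD : a ∉ D) (hbD : b ∉ D)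
    (hsub : insert v (insert a (insert b D)) ⊂ X) : D = ∅ := by
  by_contra hne
  have hne : D.Nonempty := Finset.nonempty_iff_ne_empty.mpr hne
  set P := insert v (insert a (insert b D)) with hP
  have hDP : D ⊆ P := by intro u; simp +contextual [hP]
  have h1 := hX D (lt_of_le_of_lt hDP hsub) hne
  have h2 := hX P hsub (by simp [hP])
  have hN : ∀ u, (G.neighborFinset u).card = 3 := fun u => by
    rw [card_neighborFinset_eq_degree, hcubic]
  have hside : ∀ c, G.Adj v c →
      (G.neighborFinset c ∩ D).card + (G.neighborFinset c \ P).card ≤ 2 := by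
    intro c hc
    rw [← Finset.card_union_of_disjoint]
    · have h3 : ((G.neighborFinset c).erase v).card = 2 := by
        rw [Finset.card_erase_of_mem (by simpa using hc.symm), hN]
      rw [← h3]
      refine Finset.card_le_card fun u hu => ?_
      simp only [Finset.mem_union, Finset.mem_inter, Finset.mem_sdiff, mem_neighborFinset] at hu
      rw [Finset.mem_erase, mem_neighborFinset]
      rcases hu with ⟨hu, huD⟩ | ⟨hu, huP⟩
      · exact ⟨fun h => hvD (h ▸ huD), hu⟩
      · exact ⟨fun h => huP (by simp [h, hP]), hu⟩
    · rw [Finset.disjoint_left]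
      intro u hu hu'
      exact (Finset.mem_sdiff.mp hu').2 (hDP (Finset.mem_inter.mp hu).2)
  have hv : (G.neighborFinset v \ P).card ≤ 1 := by
    have h3 : (((G.neighborFinset v).erase a).erase b).card = 1 := by
      rw [Finset.card_erase_of_mem, Finset.card_erase_of_mem, hN]
      · simpa using hva
      · simpa using ⟨hab.symm, hvb⟩
    rw [← h3]
    refine Finset.card_le_card fun u hu => ?_
    simp only [hP, Finset.mem_sdiff, Finset.mem_insert, mem_neighborFinset] at hu
    simp only [Finset.mem_erase, mem_neighborFinset]
    tauto
  have hbD : (G.dartBoundary D).card ≤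
      (G.neighborFinset a ∩ D).card + (G.neighborFinset b ∩ D).card := by
    have : G.dartBoundary D ⊆ (G.neighborFinset a ∩ D).image (fun u => (u, a)) ∪
        (G.neighborFinset b ∩ D).image (fun u => (u, b)) := by
      rintro ⟨u, w⟩ hp
      obtain ⟨hu, hw, huw⟩ := mem_dartBoundary.mp hp
      rcases hD u hu w huw with h | rfl | rfl
      · exact absurd h hw
      · simp [huw.symm, hu]
      · simp [huw.symm, hu]
    grw [this, Finset.card_union_le, Finset.card_image_le, Finset.card_image_le]
  have hbP : (G.dartBoundary P).card ≤ (G.neighborFinset v \ P).card +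
      ((G.neighborFinset a \ P).card + (G.neighborFinset b \ P).card) := by
    have : G.dartBoundary P ⊆ (G.neighborFinset v \ P).image (fun u => (v, u)) ∪
        ((G.neighborFinset a \ P).image (fun u => (a, u)) ∪
        (G.neighborFinset b \ P).image (fun u => (b, u))) := by
      rintro ⟨u, w⟩ hp
      obtain ⟨hu, hw, huw⟩ := mem_dartBoundary.mp hp
      rw [hP] at hu
      simp only [Finset.mem_insert] at hu
      rcases hu with rfl | rfl | rfl | hu
      · simp [huw, hw]
      · simp [huw, hw]
      · simp [huw, hw]
      · refine absurd ?_ hw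
        rcases hD u hu w huw with h | rfl | rfl
        · exact hDP h
        · simp [hP]
        · simp [hP]
    grw [this, Finset.card_union_le, Finset.card_union_le, Finset.card_image_le,
      Finset.card_image_le, Finset.card_image_le]
  have := hside a hva
  have := hside b hvb
  omega

/-- A connected bridgeless cubic graph has two vertices `a`, `b` with a common neighbor `v` whose
deletion leaves the graph connected. -/
lemma exists_adj_adj_connected_off_pair (hconn : G.Connected)
    (hbridgeless : ∀ e ∈ G.edgeSet, ¬ G.IsBridge e) (hcubic : ∀ v : V, G.degree v = 3) :
    ∃ v a b, a ≠ b ∧ G.Adj v a ∧ G.Adj v b ∧ ∀ D : Finset V, v ∉ D → a ∉ D → b ∉ D →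
      (∀ u ∈ D, ∀ w, G.Adj u w → w ∈ D ∨ w = a ∨ w = b) → D = ∅ := by
  have hN : ∀ u, (G.neighborFinset u).card = 3 := fun u => by
    rw [card_neighborFinset_eq_degree, hcubic]
  obtain ⟨r⟩ := hconn.nonempty
  obtain ⟨X, ⟨hXne, hX2⟩, hmin⟩ := exists_minimal_of_wellFoundedLT
    (fun X : Finset V => X.Nonempty ∧ (G.dartBoundary X).card ≤ 2)
    ⟨Finset.univ, ⟨r, by simp⟩, by simp [dartBoundary, interedges_def]⟩
  have hX : ∀ Y ⊂ X, Y.Nonempty → 3 ≤ (G.dartBoundary Y).card := by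
    intro Y hY hYne
    by_contra h
    exact hY.2 (hmin ⟨hYne, by omega⟩ hY.1)
  by_cases hXu : X = Finset.univ
  · obtain ⟨a, b, c, hab, hac, hbc, hNr⟩ := Finset.card_eq_three.mp (hN r)
    have hadj : ∀ w, G.Adj r w ↔ w = a ∨ w = b ∨ w = c := by
      intro w
      rw [← mem_neighborFinset, hNr]
      simp
    refine ⟨r, a, b, hab, (hadj a).2 (by simp), (hadj b).2 (by simp), fun D hr ha hb hD => ?_⟩
    have hra : G.Adj r a := (hadj a).2 (by simp)
    have hrb : G.Adj r b := (hadj b).2 (by simp)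
    have hrc : G.Adj r c := (hadj c).2 (by simp)
    refine eq_empty_of_closed_off_pair hcubic hX hab hra hrb hr hD ha hb ?_
    rw [hXu, Finset.ssubset_univ_iff]
    intro h
    have hc : c ∈ insert r (insert a (insert b D)) := by rw [h]; simp
    simp only [Finset.mem_insert] at hc
    rcases hc with h | h | h | h
    · exact hrc.ne h.symm
    · exact hac h.symm
    · exact hbc h.symm
    · rcases hD c h r hrc.symm with h | h | h
      · exact hr h
      · exact hra.ne h
      · exact hrb.ne h
  · obtain ⟨z, hz⟩ : ∃ z, z ∉ X := by
      by_contra! h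
      exact hXu (Finset.eq_univ_iff_forall.mpr h)
    have hX2 : (G.dartBoundary X).card = 2 :=
      le_antisymm hX2 (two_le_card_dartBoundary hconn hbridgeless hXne hz)
    obtain ⟨⟨x, x'⟩, ⟨y, y'⟩, hne, hbd⟩ := Finset.card_eq_two.mp hX2
    have hmem : ∀ u w, u ∈ X → w ∉ X → G.Adj u w → u = x ∧ w = x' ∨ u = y ∧ w = y' := by
      intro u w hu hw huw
      have := mem_dartBoundary.mpr ⟨hu, hw, huw⟩
      rw [hbd] at this
      simpa using this
    obtain ⟨hxX, hx'X, hxx'⟩ : x ∈ X ∧ x' ∉ X ∧ G.Adj x x' :=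
      mem_dartBoundary.mp (by simp [hbd])
    obtain ⟨hyX, hy'X, hyy'⟩ : y ∈ X ∧ y' ∉ X ∧ G.Adj y y' :=
      mem_dartBoundary.mp (by simp [hbd])
    have hxy : x ≠ y := by
      rintro rfl
      have hx'y' : x' ≠ y' := fun h => hne (by rw [h])
      have hcard : (((G.neighborFinset x).erase x').erase y').card = 1 := by
        rw [Finset.card_erase_of_mem, Finset.card_erase_of_mem, hN]
        · simpa using hxx'
        · simpa using ⟨hx'y'.symm, hyy'⟩
      have hsub : G.dartBoundary (X.erase x) ⊆
          (((G.neighborFinset x).erase x').erase y').image (fun u => (u, x)) := by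
        rintro ⟨u, w⟩ hp
        obtain ⟨hu, hw, huw⟩ := mem_dartBoundary.mp hp
        rw [Finset.mem_erase] at hu hw
        have hwx : w = x := by
          by_contra h
          have hwX : w ∉ X := fun h' => hw ⟨h, h'⟩
          have := hmem u w hu.2 hwX huw
          tauto
        subst hwx
        have hux' : u ≠ x' := fun h => hx'X (h ▸ hu.2)
        have huy' : u ≠ y' := fun h => hy'X (h ▸ hu.2)
        simp [huw.symm, hux', huy']
      have h1 : (G.dartBoundary (X.erase x)).card ≤ 1 := by
        grw [hsub, Finset.card_image_le, hcard]
      obtain ⟨t, ht⟩ := Finset.card_pos.mp (by omega :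
        0 < (((G.neighborFinset x).erase x').erase y').card)
      simp only [Finset.mem_erase, mem_neighborFinset] at ht
      have htX : t ∈ X := by
        by_contra h
        have := hmem x t hxX h ht.2.2
        tauto
      have := hX (X.erase x) (Finset.erase_ssubset hxX)
        ⟨t, Finset.mem_erase.mpr ⟨ht.2.2.ne', htX⟩⟩
      omega
    have hxny : ¬ G.Adj x y := by
      intro hadj
      have hx'y : x' ≠ y := fun h => hx'X (h ▸ hyX)
      have hy'x : y' ≠ x := fun h => hy'X (h ▸ hxX)
      have hcardx : (((G.neighborFinset x).erase x').erase y).card = 1 := by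
        rw [Finset.card_erase_of_mem, Finset.card_erase_of_mem, hN]
        · simpa using hxx'
        · simpa using ⟨hx'y.symm, hadj⟩
      have hcardy : (((G.neighborFinset y).erase y').erase x).card = 1 := by
        rw [Finset.card_erase_of_mem, Finset.card_erase_of_mem, hN]
        · simpa using hyy'
        · simpa using ⟨hy'x.symm, hadj.symm⟩
      have hsub : G.dartBoundary ((X.erase x).erase y) ⊆
          (((G.neighborFinset x).erase x').erase y).image (fun u => (u, x)) ∪
          (((G.neighborFinset y).erase y').erase x).image (fun u => (u, y)) := by
        rintro ⟨u, w⟩ hp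
        obtain ⟨hu, hw, huw⟩ := mem_dartBoundary.mp hp
        simp only [Finset.mem_erase] at hu hw
        have hux' : u ≠ x' := fun h => hx'X (h ▸ hu.2.2)
        have huy' : u ≠ y' := fun h => hy'X (h ▸ hu.2.2)
        by_cases hwx : w = x
        · subst hwx
          simp [huw.symm, hux', hu.1]
        by_cases hwy : w = y
        · subst hwy
          simp [huw.symm, huy', hu.2.1]
        have := hmem u w hu.2.2 (fun h => hw ⟨hwy, hwx, h⟩) huw
        tauto
      have h1 : (G.dartBoundary ((X.erase x).erase y)).card ≤ 1 + 1 := by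
        grw [hsub, Finset.card_union_le, Finset.card_image_le, Finset.card_image_le, hcardx,
          hcardy]
      obtain ⟨t, ht⟩ := Finset.card_pos.mp (by omega :
        0 < (((G.neighborFinset x).erase x').erase y).card)
      simp only [Finset.mem_erase, mem_neighborFinset] at ht
      have htX : t ∈ X := by
        by_contra h
        have := hmem x t hxX h ht.2.2
        tauto
      have := hX ((X.erase x).erase y)
        (lt_of_le_of_lt (Finset.erase_subset _ _) (Finset.erase_ssubset hxX))
        ⟨t, by simp [ht.1, ht.2.2.ne', htX]⟩
      omega
    have hcard : ((G.neighborFinset x).erase x').card = 2 := by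
      rw [Finset.card_erase_of_mem (by simpa using hxx'), hN]
    obtain ⟨a, b, hab, hNx⟩ := Finset.card_eq_two.mp hcard
    have hinX : ∀ c ∈ (G.neighborFinset x).erase x', G.Adj x c ∧ c ∈ X := by
      intro c hc
      rw [Finset.mem_erase, mem_neighborFinset] at hc
      refine ⟨hc.2, ?_⟩
      by_contra h
      have := hmem x c hxX h hc.2
      tauto
    obtain ⟨hxa, haX⟩ := hinX a (by simp [hNx])
    obtain ⟨hxb, hbX⟩ := hinX b (by simp [hNx])
    refine ⟨x, a, b, hab, hxa, hxb, fun D hxD haD hbD hD => ?_⟩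
    have hDX : D ⊆ X := by
      intro q hqD
      by_contra hqX
      have h2 := two_le_card_dartBoundary hconn hbridgeless (X := D \ X)
        ⟨q, Finset.mem_sdiff.mpr ⟨hqD, hqX⟩⟩ (z := x) (by simp [hxX])
      have hsub : G.dartBoundary (D \ X) ⊆ {(y', y)} := by
        rintro ⟨u, w⟩ hp
        obtain ⟨hu, hw, huw⟩ := mem_dartBoundary.mp hp
        rw [Finset.mem_sdiff] at hu hw
        have hwX : w ∈ X := by
          rcases hD u hu.1 w huw with h | rfl | rfl
          · by_contra h'
            exact hw ⟨h, h'⟩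
          · exact haX
          · exact hbX
        rcases hmem w u hwX hu.2 huw.symm with ⟨rfl, rfl⟩ | ⟨rfl, rfl⟩
        · rcases hD _ hu.1 _ huw with h | h | h
          · exact absurd h hxD
          · exact absurd h hxa.ne
          · exact absurd h hxb.ne
        · simp
      have := Finset.card_le_card hsub
      rw [Finset.card_singleton] at this
      omega
    refine eq_empty_of_closed_off_pair hcubic hX hab hxa hxb hxD hD haD hbD ?_
    have hy : y ∉ insert x (insert a (insert b D)) := by
      simp only [Finset.mem_insert, not_or]
      refine ⟨hxy.symm, fun h => hxny (h ▸ hxa), fun h => hxny (h ▸ hxb), fun h => ?_⟩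
      rcases hD y h y' hyy' with h | h | h
      · exact hy'X (hDX h)
      · exact hy'X (h ▸ haX)
      · exact hy'X (h ▸ hbX)
    refine Finset.ssubset_iff_subset_ne.mpr ⟨?_, fun h => hy (h ▸ hyX)⟩
    simp [Finset.insert_subset_iff, hxX, haX, hbX, hDX]

lemma exists_isAntiKekuleSet_card_le_four (hconn : G.Connected)
    (hbridgeless : ∀ e ∈ G.edgeSet, ¬ G.IsBridge e) (hcubic : ∀ v : V, G.degree v = 3) :
    ∃ S : Finset (Sym2 V), IsAntiKekuleSet G S ∧ S.card ≤ 4 := by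
  obtain ⟨v, a, b, hab, hva, hvb, hoff⟩ :=
    exists_adj_adj_connected_off_pair hconn hbridgeless hcubic
  set S := (G.incidenceFinset a).erase s(v, a) ∪ (G.incidenceFinset b).erase s(v, b) with hS
  have hleaf : ∀ c, c = a ∨ c = b → ∀ w, (G.deleteEdges (S : Set (Sym2 V))).Adj c w → w = v := by
    intro c hc w hw
    rw [deleteEdges_adj] at hw
    by_contra hwv
    refine hw.2 ?_
    rcases hc with rfl | rfl
    · simp [hS, incidenceSet, hw.1, hwv, hab, hva.ne']
    · simp [hS, incidenceSet, hw.1, hwv, hab.symm, hvb.ne']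
  have hkeep : ∀ c, c = a ∨ c = b → (G.deleteEdges (S : Set (Sym2 V))).Adj c v := by
    intro c hc
    rw [deleteEdges_adj]
    rcases hc with rfl | rfl
    · refine ⟨hva.symm, ?_⟩
      simp [hS, incidenceSet, hab.symm, hvb.ne', Sym2.eq_swap]
    · refine ⟨hvb.symm, ?_⟩
      simp [hS, incidenceSet, hab, hva.ne', Sym2.eq_swap]
  refine ⟨S, ⟨?_, ?_, ?_⟩, ?_⟩
  · intro e he
    simp only [hS, Finset.coe_union, Finset.coe_erase, Set.mem_union, Set.mem_sdiff,
      coe_incidenceFinset] at he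
    rcases he with he | he <;> exact he.1.1
  · classical
    have hreach : ∀ u, (G.deleteEdges (S : Set (Sym2 V))).Reachable v u := by
      have := hoff {u | ¬ (G.deleteEdges (S : Set (Sym2 V))).Reachable v u} (by simp)
        (by simpa using (hkeep a (.inl rfl)).reachable.symm)
        (by simpa using (hkeep b (.inr rfl)).reachable.symm) ?_
      · simpa [Finset.filter_eq_empty_iff] using this
      · intro u hu w huw
        by_contra! hw
        simp only [Finset.mem_filter, Finset.mem_univ, true_and, not_not] at hu hw
        refine hu (hw.1.trans (Adj.reachable ?_))
        have hua : u ≠ a := by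
          rintro rfl
          exact hu (hkeep u (.inl rfl)).reachable.symm
        have hub : u ≠ b := by
          rintro rfl
          exact hu (hkeep u (.inr rfl)).reachable.symm
        rw [deleteEdges_adj]
        refine ⟨huw.symm, ?_⟩
        simp [hS, incidenceSet, hua.symm, hub.symm, hw.2.1.symm, hw.2.2.symm]
    exact (connected_iff_exists_forall_reachable _).mpr ⟨v, hreach⟩
  · rintro ⟨M, hM⟩
    have hMv : ∀ c, c = a ∨ c = b → M.Adj v c := by
      intro c hc
      obtain ⟨w, hw, -⟩ := hM.1 (hM.2 c)
      exact (hleaf c hc w hw.adj_sub ▸ hw).symm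
    exact hab ((hM.1 (hM.2 v)).unique (hMv a (.inl rfl)) (hMv b (.inr rfl)))
  · rw [hS]
    grw [Finset.card_union_le]
    rw [Finset.card_erase_of_mem, Finset.card_erase_of_mem, card_incidenceFinset_eq_degree,
      card_incidenceFinset_eq_degree, hcubic, hcubic]
    · simpa [incidenceSet] using hvb
    · simpa [incidenceSet] using hva

lemma three_mul_card_le_of_disjoint_odd (hconn : G.Connected)
    (hbridgeless : ∀ e ∈ G.edgeSet, ¬ G.IsBridge e) (hcubic : ∀ v : V, G.degree v = 3)
    {S : Finset (Sym2 V)} {U : Finset V} {ι : Type*} (I : Finset ι) (C : ι → Finset V)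
    (hodd : ∀ i ∈ I, Odd (C i).card) (hdisj : (I : Set ι).PairwiseDisjoint C)
    (hout : ∀ i ∈ I, ∀ u ∈ C i, ∀ w, G.Adj u w → w ∈ C i ∨ w ∈ U ∨ s(u, w) ∈ S) :
    3 * I.card ≤ 3 * U.card + 2 * S.card := by
  have hC : ∀ i ∈ I, 3 ≤ (G.dartBoundary (C i)).card := by
    intro i hi
    obtain ⟨z, hz⟩ : ∃ z, z ∉ C i := by
      by_contra! h
      have h1 := hodd i hi
      rw [Finset.eq_univ_iff_forall.mpr h, Finset.card_univ, ← Nat.card_eq_fintype_card] at h1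
      exact Nat.not_odd_iff_even.mpr (even_card_of_cubic hcubic) h1
    have h2 := two_le_card_dartBoundary hconn hbridgeless
      (Finset.card_pos.mp (hodd i hi).pos) hz
    obtain ⟨k, hk⟩ := odd_card_dartBoundary hcubic (hodd i hi)
    omega
  have hsub : I.biUnion (fun i => G.dartBoundary (C i)) ⊆
      U.biUnion (fun w => (G.neighborFinset w).image (fun u => (u, w))) ∪
      S.biUnion (fun e => Finset.univ.filter (fun p : V × V => s(p.1, p.2) = e)) := by
    rintro ⟨u, w⟩ hp
    obtain ⟨i, hi, hp⟩ := Finset.mem_biUnion.mp hp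
    obtain ⟨hu, hw, huw⟩ := mem_dartBoundary.mp hp
    rcases hout i hi u hu w huw with h | h | h
    · exact absurd h hw
    · simp [h, huw.symm]
    · simp [h]
  have hfiber : ∀ e : Sym2 V,
      (Finset.univ.filter (fun p : V × V => s(p.1, p.2) = e)).card ≤ 2 := by
    intro e
    induction e with
    | h x y =>
      refine le_trans (Finset.card_le_card (t := {(x, y), (y, x)}) ?_) Finset.card_le_two
      rintro ⟨u, w⟩ h
      simpa using h
  calc 3 * I.card = ∑ i ∈ I, 3 := by simp [mul_comm]
    _ ≤ ∑ i ∈ I, (G.dartBoundary (C i)).card := Finset.sum_le_sum hC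
    _ = (I.biUnion fun i => G.dartBoundary (C i)).card := by
        refine (Finset.card_biUnion fun i hi j hj hij => ?_).symm
        refine Finset.disjoint_left.mpr ?_
        rintro ⟨u, w⟩ h1 h2
        exact Finset.disjoint_left.mp (hdisj hi hj hij) (mem_dartBoundary.mp h1).1
          (mem_dartBoundary.mp h2).1
    _ ≤ _ := Finset.card_le_card hsub
    _ ≤ U.card * 3 + S.card * 2 := by
        refine (Finset.card_union_le _ _).trans (add_le_add ?_ ?_)
        · refine Finset.card_biUnion_le_card_mul _ _ _ fun w _ => Finset.card_image_le.trans ?_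
          rw [card_neighborFinset_eq_degree, hcubic]
        · exact Finset.card_biUnion_le_card_mul _ _ _ fun e _ => hfiber e
    _ = _ := by ring

lemma three_le_card_of_isAntiKekuleSet (hconn : G.Connected)
    (hbridgeless : ∀ e ∈ G.edgeSet, ¬ G.IsBridge e) (hcubic : ∀ v : V, G.degree v = 3)
    {S : Finset (Sym2 V)} (hS : IsAntiKekuleSet G S) : 3 ≤ S.card := by
  classical
  obtain ⟨-, -, hpm⟩ := hS
  rw [tutte] at hpm
  push Not at hpm
  obtain ⟨U, hU⟩ := hpm
  rw [IsTutteViolator] at hU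
  set H := ((⊤ : (G.deleteEdges (S : Set (Sym2 V))).Subgraph).deleteVerts U).coe with hH
  have hfin := three_mul_card_le_of_disjoint_odd hconn hbridgeless hcubic (S := S)
    (U := U.toFinset) H.oddComponents.toFinset
    (fun c => (c.supp.toFinset).map (Function.Embedding.subtype _)) ?_ ?_ ?_
  · have hpar := odd_ncard_oddComponents H
    have hcard : Nat.card ((⊤ : (G.deleteEdges (S : Set (Sym2 V))).Subgraph).deleteVerts U).verts
        + U.ncard = Nat.card V := by
      rw [Subgraph.deleteVerts_verts, Subgraph.verts_top, ← Set.compl_eq_univ_sdiff,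
        Nat.card_coe_set_eq, add_comm]
      exact Set.ncard_add_ncard_compl U
    have heven := even_card_of_cubic hcubic
    rw [← Set.ncard_eq_toFinset_card', ← Set.ncard_eq_toFinset_card'] at hfin
    rw [Nat.odd_iff, Nat.odd_iff] at hpar
    rw [Nat.even_iff] at heven
    omega
  · intro c hc
    rw [Finset.card_map, ← Set.ncard_eq_toFinset_card']
    simpa using hc
  · intro c hc d hd hcd
    refine (Finset.disjoint_map _).mpr (Set.disjoint_toFinset.mpr ?_)
    exact pairwise_disjoint_supp_connectedComponent _ hcd
  · intro c hc u hu w huw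
    by_contra! hw
    obtain ⟨hw1, hw2, hw3⟩ := hw
    rw [Finset.mem_map] at hu
    obtain ⟨u, hu, rfl⟩ := hu
    rw [Set.mem_toFinset] at hu
    rw [Set.mem_toFinset] at hw2
    refine hw1 (Finset.mem_map.mpr ⟨⟨w, by simpa using hw2⟩, ?_, rfl⟩)
    rw [Set.mem_toFinset]
    refine c.mem_supp_of_adj_mem_supp hu ?_
    rw [hH, Subgraph.coe_adj, Subgraph.deleteVerts_adj]
    exact ⟨trivial, u.2.2, trivial, hw2, deleteEdges_adj.mpr ⟨huw, by simpa using hw3⟩⟩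

end SimpleGraph

/-- If `G` is a finite 2-connected (equivalently, connected and bridgeless) cubic graph,
then `3 ≤ ak(G) ≤ 4`: every anti-Kekulé set has at least 3 edges, and there is an
anti-Kekulé set with at most 4 edges. -/
theorem antiKekule_two_connected_cubic {V : Type*} [Fintype V] [DecidableEq V]
    (G : SimpleGraph V) [DecidableRel G.Adj]
    (hconn : G.Connected) (hbridgeless : ∀ e ∈ G.edgeSet, ¬ G.IsBridge e)
    (hcubic : ∀ v : V, G.degree v = 3) :
    (∀ S : Finset (Sym2 V), IsAntiKekuleSet G S → 3 ≤ S.card) ∧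
      (∃ S : Finset (Sym2 V), IsAntiKekuleSet G S ∧ S.card ≤ 4) := by
  exact ⟨fun _ hS => three_le_card_of_isAntiKekuleSet hconn hbridgeless hcubic hS,
    exists_isAntiKekuleSet_card_le_four hconn hbridgeless hcubic⟩
end

section
/- If G is a finite 2-connected cubic graph (equivalently, a finite bridgeless cubic graph), then every anti-Kekulé set of G contains at least 3 edges; that is, for every edge set S ⊆ E(G) with |S| ≤ 2 such that G − S is connected, the graph G − S has a perfect matching. -/
open SimpleGraph

namespace SimpleGraph

variable {V : Type*} [Fintype V] [DecidableEq V] (G : SimpleGraph V) [DecidableRel G.Adj]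

/-- The ordered adjacent pairs leaving the vertex set `A`, i.e. the oriented edge cut of `A`. -/
def cutPairs (A : Finset V) : Finset (V × V) :=
  Finset.univ.filter fun p => G.Adj p.1 p.2 ∧ p.1 ∈ A ∧ p.2 ∉ A

lemma mem_cutPairs {A : Finset V} {p : V × V} :
    p ∈ G.cutPairs A ↔ G.Adj p.1 p.2 ∧ p.1 ∈ A ∧ p.2 ∉ A := by
  simp [cutPairs]

/-- The number of ordered adjacent pairs starting in `A` is the sum of the degrees over `A`. -/
lemma card_filter_adj_fst_mem (A : Finset V) :
    (Finset.univ.filter fun p : V × V => G.Adj p.1 p.2 ∧ p.1 ∈ A).card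
      = ∑ v ∈ A, G.degree v := by
  rw [Finset.card_eq_sum_card_fiberwise (f := Prod.fst) (t := A)
    (fun p hp => by simpa using (Finset.mem_filter.1 hp).2.2)]
  refine Finset.sum_congr rfl fun v hv => ?_
  rw [← G.card_neighborFinset_eq_degree,
    ← Finset.card_image_of_injective (G.neighborFinset v) (Prod.mk_right_injective v)]
  congr 1
  ext ⟨x, y⟩
  simp only [Finset.mem_filter, Finset.mem_univ, true_and, Finset.mem_image, mem_neighborFinset,
    Prod.mk.injEq]
  constructor
  · rintro ⟨⟨h, -⟩, rfl⟩
    exact ⟨y, h, rfl, rfl⟩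
  · rintro ⟨_, h, rfl, rfl⟩
    exact ⟨⟨h, hv⟩, rfl⟩

/-- The number of ordered adjacent pairs inside `A` is even. -/
lemma even_card_filter_adj_mem (A : Finset V) :
    Even (Finset.univ.filter fun p : V × V => G.Adj p.1 p.2 ∧ p.1 ∈ A ∧ p.2 ∈ A).card := by
  let K : SimpleGraph V :=
    { Adj := fun x y => G.Adj x y ∧ x ∈ A ∧ y ∈ A
      symm := ⟨fun _ _ h => ⟨h.1.symm, h.2.2, h.2.1⟩⟩
      loopless := ⟨fun _ h => G.irrefl h.1⟩ }
  have : DecidableRel K.Adj := fun x y => inferInstanceAs (Decidable (G.Adj x y ∧ x ∈ A ∧ y ∈ A))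
  have h := K.card_filter_adj_fst_mem Finset.univ
  rw [K.sum_degrees_eq_twice_card_edges] at h
  simp only [Finset.mem_univ, and_true] at h
  exact ⟨K.edgeFinset.card, by rw [← two_mul, ← h]; congr⟩

/-- Parity of an edge cut in a graph all of whose degrees are odd. -/
lemma odd_card_cutPairs_iff (hodd : ∀ v, Odd (G.degree v)) (A : Finset V) :
    Odd (G.cutPairs A).card ↔ Odd A.card := by
  have hsplit := Finset.card_filter_add_card_filter_not
    (s := Finset.univ.filter fun p : V × V => G.Adj p.1 p.2 ∧ p.1 ∈ A) (fun p => p.2 ∈ A)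
  rw [card_filter_adj_fst_mem] at hsplit
  simp only [Finset.filter_filter, and_assoc] at hsplit
  have hsum : Odd (∑ v ∈ A, G.degree v) ↔ Odd A.card := by
    rw [Finset.odd_sum_iff_odd_card_odd, Finset.filter_true_of_mem fun v _ => hodd v]
  rw [← hsum, ← hsplit, Nat.odd_add', cutPairs]
  simp only [G.even_card_filter_adj_mem A, iff_true]

/-- An edge cut consisting of a single edge is a bridge. -/
lemma card_cutPairs_ne_one (hbridgeless : ∀ e ∈ G.edgeSet, ¬ G.IsBridge e) (A : Finset V) :
    (G.cutPairs A).card ≠ 1 := by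
  intro h
  obtain ⟨⟨x, y⟩, hxy⟩ := Finset.card_eq_one.1 h
  obtain ⟨hadj, hx, hy⟩ := G.mem_cutPairs.1 (hxy ▸ Finset.mem_singleton_self (x, y))
  refine hbridgeless s(x, y) hadj (isBridge_iff.2 ?_)
  rintro ⟨p⟩
  obtain ⟨d, -, hd1, hd2⟩ := p.exists_boundary_dart (A : Set V) hx hy
  have hd := d.adj
  rw [deleteEdges_adj] at hd
  have hmem : (d.fst, d.snd) ∈ G.cutPairs A := G.mem_cutPairs.2 ⟨hd.1, hd1, hd2⟩
  rw [hxy, Finset.mem_singleton, Prod.mk.injEq] at hmem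
  exact hd.2 (by simp [hmem.1, hmem.2])

lemma three_le_card_cutPairs (hodd : ∀ v, Odd (G.degree v))
    (hbridgeless : ∀ e ∈ G.edgeSet, ¬ G.IsBridge e) {A : Finset V} (hA : Odd A.card) :
    3 ≤ (G.cutPairs A).card := by
  obtain ⟨k, hk⟩ := (G.odd_card_cutPairs_iff hodd A).2 hA
  have := G.card_cutPairs_ne_one hbridgeless A
  omega

/-- Disjoint sets `A i` whose outgoing edges end in `U` or belong to `S` have few outgoing
edges in total. -/
lemma sum_card_cutPairs_le {ι : Type*} (I : Finset ι) (A : ι → Finset V)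
    (hdisj : Pairwise fun i j => Disjoint (A i) (A j)) (U : Finset V) (S : Finset (Sym2 V))
    (hcut : ∀ i, ∀ p ∈ G.cutPairs (A i), p.2 ∈ U ∨ s(p.1, p.2) ∈ S) :
    ∑ i ∈ I, (G.cutPairs (A i)).card ≤ ∑ v ∈ U, G.degree v + 2 * S.card := by
  classical
  rw [← Finset.card_biUnion fun i _ j _ hij => Finset.disjoint_left.2 fun p hi hj =>
    Finset.disjoint_left.1 (hdisj hij) (G.mem_cutPairs.1 hi).2.1 (G.mem_cutPairs.1 hj).2.1]
  have hS : (Finset.univ.filter fun p : V × V => s(p.1, p.2) ∈ S).card ≤ 2 * S.card := by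
    refine Finset.card_le_mul_card_image_of_maps_to (f := fun p : V × V => s(p.1, p.2))
      (fun p hp => (Finset.mem_filter.1 hp).2) 2 fun e _ => ?_
    induction e with
    | h a b =>
      refine (Finset.card_le_card (t := {(a, b), (b, a)}) fun p hp => ?_).trans Finset.card_le_two
      obtain ⟨x, y⟩ := p
      simpa using (Finset.mem_filter.1 hp).2
  have hU : (Finset.univ.filter fun p : V × V => G.Adj p.1 p.2 ∧ p.2 ∈ U).card
      = ∑ v ∈ U, G.degree v := by
    rw [← card_filter_adj_fst_mem]
    refine Finset.card_bij' (fun p _ => p.swap) (fun p _ => p.swap) ?_ ?_ ?_ ?_ <;>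
      simp +contextual [G.adj_comm]
  rw [← hU]
  refine (Finset.card_le_card fun p hp => ?_).trans
    ((Finset.card_union_le _ _).trans (Nat.add_le_add_left hS _))
  obtain ⟨i, -, hp⟩ := Finset.mem_biUnion.1 hp
  have hadj := (G.mem_cutPairs.1 hp).1
  simpa [hadj] using hcut i p hp

end SimpleGraph

/-- If `G` is a finite 2-connected (equivalently, connected and bridgeless) cubic graph,
then every anti-Kekulé set of `G` has at least 3 edges: for every edge set `S` with
`|S| ≤ 2` such that `G - S` is connected, `G - S` has a perfect matching. -/
theorem antiKekule_lower_bound_cubic {V : Type*} [Fintype V] [DecidableEq V]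
    (G : SimpleGraph V) [DecidableRel G.Adj]
    (hconn : G.Connected) (hbridgeless : ∀ e ∈ G.edgeSet, ¬ G.IsBridge e)
    (hcubic : ∀ v : V, G.degree v = 3)
    (S : Finset (Sym2 V)) (hS : ↑S ⊆ G.edgeSet) (hcard : S.card ≤ 2)
    (hconn' : (G.deleteEdges ↑S).Connected) :
    ∃ M : (G.deleteEdges ↑S).Subgraph, M.IsPerfectMatching := by
  classical
  have hodd : ∀ v, Odd (G.degree v) := fun v => hcubic v ▸ by decide
  rw [tutte]
  intro u hu
  rw [IsTutteViolator] at hu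
  set K := ((⊤ : (G.deleteEdges (S : Set (Sym2 V))).Subgraph).deleteVerts u) with hK
  have hverts : K.verts = uᶜ := by ext; simp [hK]
  have hV : ¬ Odd (Nat.card V) := by
    have h := G.odd_card_cutPairs_iff hodd Finset.univ
    rw [Nat.card_eq_fintype_card, ← Finset.card_univ, ← h]
    simp [cutPairs]
  have hpar : Odd K.coe.oddComponents.ncard ↔ Odd uᶜ.ncard := by
    rw [odd_ncard_oddComponents, Nat.card_coe_set_eq, hverts]
  have hadd := Set.ncard_add_ncard_compl u
  let A : K.coe.ConnectedComponent → Finset V := fun c => (Subtype.val '' c.supp).toFinset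
  have hA : ∀ c v, v ∈ A c ↔ ∃ h : v ∈ K.verts, K.coe.connectedComponentMk ⟨v, h⟩ = c := by
    simp [A]
  have hdisj : Pairwise fun c d => Disjoint (A c) (A d) := by
    refine fun c d hcd => Finset.disjoint_left.2 fun v hc hd => hcd ?_
    obtain ⟨_, rfl⟩ := (hA _ _).1 hc
    obtain ⟨_, rfl⟩ := (hA _ _).1 hd
    rfl
  have hle := G.sum_card_cutPairs_le K.coe.oddComponents.toFinset A hdisj u.toFinset S (by
    rintro c ⟨x, y⟩ hp
    obtain ⟨hadj, hx, hy⟩ := G.mem_cutPairs.1 hp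
    by_contra! hne
    obtain ⟨hxK, rfl⟩ := (hA _ _).1 hx
    have hyu : y ∉ u := by simpa using hne.1
    have hxu : x ∉ u := by simpa [hverts] using hxK
    refine hy ((hA _ _).2 ⟨by simpa [hverts] using hyu, ConnectedComponent.eq.2 ?_⟩)
    refine (Adj.reachable ?_).symm
    simpa [hK, hxu, hyu, hadj] using hne.2)
  have hge : K.coe.oddComponents.toFinset.card * 3
      ≤ ∑ c ∈ K.coe.oddComponents.toFinset, (G.cutPairs (A c)).card := by
    refine Finset.card_nsmul_le_sum _ _ 3 fun c hc => G.three_le_card_cutPairs hodd hbridgeless ?_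
    have hc' : Odd c.supp.ncard := by simpa using hc
    rwa [← Set.ncard_eq_toFinset_card', Set.ncard_image_of_injective _ Subtype.val_injective]
  rw [Finset.sum_congr rfl fun v _ => hcubic v, Finset.sum_const, smul_eq_mul,
    ← Set.ncard_eq_toFinset_card'] at hle
  rw [← Set.ncard_eq_toFinset_card'] at hge
  rw [Nat.odd_iff] at hV
  rw [Nat.odd_iff, Nat.odd_iff] at hpar
  omega
end

section
/- If G is a finite connected cubic bipartite graph, then the anti-Kekulé number of G equals 4; that is, G has an anti-Kekulé set with exactly 4 edges, and every anti-Kekulé set of G has at least 4 edges. -/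
open SimpleGraph

open Finset in
/-- In a cubic bipartite graph, deleting at most three edges without disconnecting the graph
preserves Hall's condition on each side of the bipartition. -/
lemma card_le_card_filter_adj_of_connected_deleteEdges
    {V : Type*} [Fintype V] [DecidableEq V] (G : SimpleGraph V) [DecidableRel G.Adj]
    (hcubic : ∀ v : V, G.degree v = 3) {p q : Set V} (hpq : G.IsBipartiteWith p q)
    (S : Finset (Sym2 V)) (hS : S.card ≤ 3) (hconn : (G.deleteEdges ↑S).Connected)
    (X : Finset V) (hX : ∀ x ∈ X, x ∈ p) :
    X.card ≤ (univ.filter fun y ↦ ∃ x ∈ X, (G.deleteEdges ↑S).Adj x y).card := by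
  set N := univ.filter fun y ↦ ∃ x ∈ X, (G.deleteEdges ↑S).Adj x y with hN
  by_contra! hlt
  have memN : ∀ y, y ∈ N ↔ ∃ x ∈ X, (G.deleteEdges ↑S).Adj x y := by simp [hN]
  have hq : ∀ x ∈ X, ∀ y, G.Adj x y → y ∈ q := fun x hx y h ↦ hpq.mem_of_mem_adj (hX x hx) h
  have hdisj : ∀ x ∈ p, x ∉ q := fun x hp hq ↦ Set.disjoint_left.mp hpq.disjoint hp hq
  let E₁ : Finset (V × V) := univ.filter fun e ↦ e.1 ∈ X ∧ G.Adj e.1 e.2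
  let E₂ : Finset (V × V) := univ.filter fun e ↦ e.2 ∈ N ∧ G.Adj e.1 e.2
  have hE₁ : E₁.card = 3 * X.card := by
    rw [card_eq_sum_card_fiberwise (f := Prod.fst) (t := X) (by intro e; simp +contextual [E₁])]
    rw [sum_const_nat (m := 3), mul_comm]
    intro x hx
    rw [← hcubic x, ← G.card_neighborFinset_eq_degree x]
    refine card_bij (fun e _ ↦ e.2) ?_ ?_ ?_
    · simp +contextual only [E₁, mem_filter, mem_neighborFinset]
      rintro ⟨a, b⟩ ⟨h, rfl⟩
      exact h.2.2
    · simp only [E₁, mem_filter]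
      rintro ⟨a, b⟩ ⟨_, rfl⟩ ⟨c, d⟩ ⟨_, h⟩ h'
      simp_all
    · intro b hb
      exact ⟨(x, b), by simpa [E₁, hx] using hb, rfl⟩
  have hE₂ : E₂.card = 3 * N.card := by
    rw [card_eq_sum_card_fiberwise (f := Prod.snd) (t := N) (by intro e; simp +contextual [E₂])]
    rw [sum_const_nat (m := 3), mul_comm]
    intro x hx
    rw [← hcubic x, ← G.card_neighborFinset_eq_degree x]
    refine card_bij (fun e _ ↦ e.1) ?_ ?_ ?_
    · simp +contextual only [E₂, mem_filter, mem_neighborFinset]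
      rintro ⟨a, b⟩ ⟨h, rfl⟩
      exact h.2.2.symm
    · simp only [E₂, mem_filter]
      rintro ⟨a, b⟩ ⟨_, rfl⟩ ⟨c, d⟩ ⟨_, h⟩ h'
      simp_all
    · intro b hb
      exact ⟨(b, x), by simpa [E₂, hx, G.adj_comm] using hb, rfl⟩
  have hdiff : (E₁ \ E₂).card ≤ S.card := by
    refine card_le_card_of_injOn (fun e ↦ s(e.1, e.2)) ?_ ?_
    · rintro ⟨x, y⟩ h
      simp only [E₁, E₂, coe_sdiff, Set.mem_sdiff, mem_coe, mem_filter, mem_univ, true_and] at h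
      obtain ⟨⟨hx, hxy⟩, h⟩ := h
      by_contra hxyS
      exact h ⟨(memN y).mpr ⟨x, hx, by rw [deleteEdges_adj]; exact ⟨hxy, hxyS⟩⟩, hxy⟩
    · rintro ⟨x, y⟩ h ⟨x', y'⟩ h' heq
      simp only [E₁, coe_sdiff, Set.mem_sdiff, mem_coe, mem_filter, mem_univ, true_and] at h h'
      rcases Sym2.eq_iff.mp heq with ⟨rfl, rfl⟩ | ⟨rfl, rfl⟩
      · rfl
      · exact absurd (hq _ h'.1.1 _ h'.1.2) (hdisj _ (hX _ h.1.1))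
  have h₁ := card_sdiff_add_card_inter E₁ E₂
  have h₂ := card_sdiff_add_card_inter E₂ E₁
  rw [inter_comm] at h₂
  have hsub : E₂ ⊆ E₁ := by
    rw [← sdiff_eq_empty_iff_subset, ← card_eq_zero]
    lia
  have hne : (E₁ \ E₂).Nonempty := by
    rw [← card_pos]
    lia
  obtain ⟨⟨x₀, y₀⟩, h₀⟩ := hne
  simp only [E₁, E₂, mem_sdiff, mem_filter, mem_univ, true_and] at h₀
  have hclosed : ∀ w, (G.deleteEdges ↑S).Reachable x₀ w → w ∈ X ∨ w ∈ N := by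
    intro w hw
    rw [reachable_iff_reflTransGen] at hw
    induction hw with
    | refl => exact Or.inl h₀.1.1
    | @tail b c _ hbc ih =>
      rcases ih with hb | hb
      · exact Or.inr ((memN c).mpr ⟨b, hb, hbc⟩)
      · have hcb : (c, b) ∈ E₂ := by
          simp only [E₂, mem_filter, mem_univ, true_and]
          exact ⟨hb, (deleteEdges_le _ hbc).symm⟩
        have := hsub hcb
        simp only [E₁, mem_filter, mem_univ, true_and] at this
        exact Or.inl this.1
  rcases hclosed y₀ (hconn.preconnected x₀ y₀) with h | h
  · exact hdisj _ (hX _ h) (hq _ h₀.1.1 _ h₀.1.2)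
  · exact h₀.2 ⟨h, h₀.1.2⟩

/-- A connected graph obtained from a cubic bipartite graph by deleting at most three edges has
a perfect matching. -/
lemma exists_isPerfectMatching_deleteEdges_of_card_le_three
    {V : Type*} [Fintype V] [DecidableEq V] (G : SimpleGraph V) [DecidableRel G.Adj]
    (hbip : G.Colorable 2) (hcubic : ∀ v : V, G.degree v = 3)
    (S : Finset (Sym2 V)) (hS : S.card ≤ 3) (hconn : (G.deleteEdges ↑S).Connected) :
    ∃ M : (G.deleteEdges ↑S).Subgraph, M.IsPerfectMatching := by
  classical
  let c := hbip.some
  let p : Set V := {v | c v = 0}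
  let q : Set V := {v | c v = 1}
  have hcov : ∀ v, v ∈ p ∨ v ∈ q := fun v ↦ by
    change c v = 0 ∨ c v = 1
    lia
  have hpq : G.IsBipartiteWith p q := by
    refine ⟨Set.disjoint_left.mpr fun v (h : c v = 0) (h' : c v = 1) ↦ by simp [h] at h', ?_⟩
    intro v w hvw
    have := c.valid hvw
    change (c v = 0 ∧ c w = 1) ∨ (c v = 1 ∧ c w = 0)
    lia
  have hpq' : (G.deleteEdges (↑S : Set (Sym2 V))).IsBipartiteWith p q :=
    ⟨hpq.disjoint, fun _ _ h ↦ hpq.mem_of_adj (deleteEdges_le _ h)⟩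
  refine exists_isPerfectMatching_of_forall_ncard_le hpq' fun s ↦ ?_
  let X := Finset.univ.filter fun v ↦ v ∈ s ∧ v ∈ p
  let Y := Finset.univ.filter fun v ↦ v ∈ s ∧ v ∈ q
  have hX := card_le_card_filter_adj_of_connected_deleteEdges G hcubic hpq S hS
    hconn X (by simp +contextual [X])
  have hY := card_le_card_filter_adj_of_connected_deleteEdges G hcubic hpq.symm S hS
    hconn Y (by simp +contextual [Y])
  have hs : s.ncard ≤ X.card + Y.card := by
    rw [← Set.ncard_coe_finset, ← Set.ncard_coe_finset]
    refine le_trans (Set.ncard_le_ncard (fun v hv ↦ ?_)) (Set.ncard_union_le _ _)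
    simpa [X, Y, hv] using hcov v
  refine hs.trans ((add_le_add hX hY).trans ?_)
  rw [← Finset.card_union_of_disjoint, ← Set.ncard_coe_finset]
  · refine Set.ncard_le_ncard fun v hv ↦ ?_
    simp only [Finset.coe_union, Finset.coe_filter, Set.mem_union, Set.mem_ofPred_eq,
      Finset.mem_univ, true_and, X, Y, Finset.mem_filter] at hv
    simp only [Set.mem_iUnion, mem_neighborSet]
    rcases hv with ⟨x, hx, h⟩ | ⟨x, hx, h⟩ <;> exact ⟨x, hx.1, h⟩
  · rw [Finset.disjoint_left]
    simp only [Finset.mem_filter, Finset.mem_univ, true_and, X, Y]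
    rintro v ⟨x, hx, h⟩ ⟨y, hy, h'⟩
    exact Set.disjoint_left.mp hpq'.disjoint (hpq'.symm.mem_of_mem_adj hy.2 h')
      (hpq'.mem_of_mem_adj hx.2 h)

/-- A longest path, as a list of vertices. -/
lemma exists_isChain_nodup_forall_length_le {V : Type*} [Fintype V] (r : V → V → Prop) :
    ∃ l : List V, (l.IsChain r ∧ l.Nodup) ∧
      ∀ l' : List V, l'.IsChain r → l'.Nodup → l'.length ≤ l.length := by
  by_contra! h
  have key : ∀ n : ℕ, ∃ l : List V, (l.IsChain r ∧ l.Nodup) ∧ n ≤ l.length := by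
    intro n
    induction n with
    | zero => exact ⟨[], by simp⟩
    | succ n ih =>
      obtain ⟨l, hl, hn⟩ := ih
      obtain ⟨l', h₁, h₂, h₃⟩ := h l hl
      exact ⟨l', ⟨h₁, h₂⟩, by lia⟩
  obtain ⟨l, hl, hn⟩ := key (Fintype.card V + 1)
  have := hl.2.length_le_card
  lia

lemma reachable_of_mem_of_isChain_cons {V : Type*} {G : SimpleGraph V} {v : V} {l : List V}
    (h : (v :: l).IsChain G.Adj) : ∀ w ∈ v :: l, G.Reachable v w := by
  induction l generalizing v with
  | nil => simp
  | cons a l ih =>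
    rw [List.isChain_cons_cons] at h
    intro w hw
    rcases List.mem_cons.mp hw with rfl | hw
    · rfl
    · exact h.1.reachable.trans (ih h.2 w hw)

/-- The first three vertices of a longest path can be chosen so that deleting all edges at the
two end vertices other than the edges of the path leaves a cubic graph connected. -/
lemma exists_connected_of_two_pendant_vertices {V : Type*} [Fintype V] [DecidableEq V]
    (G : SimpleGraph V) [DecidableRel G.Adj] (hconn : G.Connected)
    (hcubic : ∀ v : V, G.degree v = 3) :
    ∃ a b c : V, G.Adj a b ∧ G.Adj b c ∧ a ≠ c ∧ ∀ H : SimpleGraph V,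
      H.Adj a b → H.Adj b c →
      (∀ u w, G.Adj u w → u ≠ a → u ≠ c → w ≠ a → w ≠ c → H.Adj u w) → H.Connected := by
  obtain ⟨l, hl, hmax⟩ := exists_isChain_nodup_forall_length_le G.Adj
  have hext : ∀ x l', (x :: l').IsChain G.Adj → (x :: l').Nodup → (x :: l').length = l.length →
      ∀ y, G.Adj x y → y ∈ l' := by
    intro x l' h₁ h₂ h₃ y hy
    by_contra hyl
    have := hmax (y :: x :: l') (List.isChain_cons_cons.mpr ⟨hy.symm, h₁⟩)
      (List.nodup_cons.mpr ⟨by simp [hy.ne', hyl], h₂⟩)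
    simp only [List.length_cons] at this h₃
    lia
  have hthird : ∀ v a b : V, ∃ w, G.Adj v w ∧ w ≠ a ∧ w ≠ b := by
    intro v a b
    have : ({a, b} : Finset V).card < (G.neighborFinset v).card := by
      rw [card_neighborFinset_eq_degree, hcubic]
      exact Nat.lt_succ_of_le Finset.card_le_two
    obtain ⟨w, hw, hw'⟩ := Finset.exists_mem_notMem_of_card_lt_card this
    simp only [Finset.mem_insert, Finset.mem_singleton, not_or] at hw'
    exact ⟨w, by simpa using hw, hw'⟩
  have hlen : 4 ≤ l.length := by
    rcases l with _ | ⟨x, l'⟩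
    · obtain ⟨v⟩ := hconn.nonempty
      have := hmax [v] (by simp) (by simp)
      simp at this
    · have hsub : G.neighborFinset x ⊆ l'.toFinset := by
        intro y hy
        rw [List.mem_toFinset]
        exact hext x l' hl.1 hl.2 rfl y (by simpa using hy)
      have h₁ := Finset.card_le_card hsub
      rw [card_neighborFinset_eq_degree, hcubic] at h₁
      have h₂ := l'.toFinset_card_le
      simp only [List.length_cons]
      lia
  obtain ⟨a, b, c, d, L, rfl⟩ : ∃ a b c d L, l = a :: b :: c :: d :: L := by
    match l, hlen with
    | a :: b :: c :: d :: L, _ => exact ⟨a, b, c, d, L, rfl⟩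
  obtain ⟨hchain, hnodup⟩ := hl
  have hchain' := hchain
  simp only [List.isChain_cons_cons] at hchain'
  obtain ⟨hab, hbc, hcd, hdL⟩ := hchain'
  have hnd := hnodup
  simp only [List.nodup_cons, List.mem_cons, not_or] at hnd
  refine ⟨a, b, c, hab, hbc, hnd.1.2.1, fun H hHab hHbc hH ↦ ?_⟩
  have hdne : ∀ w ∈ d :: L, w ≠ a ∧ w ≠ b ∧ w ≠ c := by
    intro w hw
    refine ⟨?_, ?_, ?_⟩ <;> rintro rfl <;> simp only [List.mem_cons] at hw <;> tauto
  have hL : ∀ w ∈ d :: L, H.Reachable d w := by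
    apply reachable_of_mem_of_isChain_cons
    refine List.IsChain.imp_of_mem_imp (R := G.Adj) ?_ hdL
    intro u w hu hw huw
    exact hH u w huw (hdne u hu).1 (hdne u hu).2.2 (hdne w hw).1 (hdne w hw).2.2
  have hA : ∀ u, u ≠ b → u ≠ c → G.Adj a u → u ∈ d :: L := by
    intro u hb hc hu
    have := hext a _ hchain hnodup rfl u hu
    simpa [hb, hc] using this
  have hB : ∀ u, u ≠ a → u ≠ c → G.Adj b u → H.Reachable d u := by
    intro u ha hc hu
    by_cases huL : u ∈ d :: L
    · exact hL u huL
    obtain ⟨w, huw, hwb, hwc⟩ := hthird u b c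
    have hw := hext u (b :: c :: d :: L)
      (List.isChain_cons_cons.mpr ⟨hu.symm, (List.isChain_cons_cons.mp hchain).2⟩)
      (List.nodup_cons.mpr ⟨by simpa [hu.ne', hc] using huL, (List.nodup_cons.mp hnodup).2⟩)
      rfl w huw
    have hw' : w ∈ d :: L := by simpa [hwb, hwc] using hw
    exact (hL w hw').trans
      (hH w u huw.symm (hdne w hw').1 (hdne w hw').2.2 ha hc).reachable
  have hC : ∀ u, u ≠ a → u ≠ b → G.Adj c u → H.Reachable d u := by
    intro u ha hb hu
    by_cases huL : u ∈ d :: L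
    · exact hL u huL
    by_cases hub : G.Adj b u
    · exact hB u ha hu.ne' hub
    obtain ⟨w, huw, hwc, -⟩ := hthird u c c
    have hwa : w ≠ a := by
      rintro rfl
      exact huL (hA u hb hu.ne' huw.symm)
    have hwb : w ≠ b := by
      rintro rfl
      exact hub huw.symm
    have hwu : H.Adj w u := hH w u huw.symm hwa hwc ha hu.ne'
    by_cases hwL : w ∈ d :: L
    · exact (hL w hwL).trans hwu.reachable
    obtain ⟨t, hwt, htu, htc⟩ := hthird w u c
    have hcL : (c :: d :: L).IsChain G.Adj :=
      (List.isChain_cons_cons.mp (List.isChain_cons_cons.mp hchain).2).2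
    have hcN : (c :: d :: L).Nodup := (List.nodup_cons.mp (List.nodup_cons.mp hnodup).2).2
    have ht := hext w (u :: c :: d :: L)
      (List.isChain_cons_cons.mpr ⟨huw.symm, List.isChain_cons_cons.mpr ⟨hu.symm, hcL⟩⟩)
      (List.nodup_cons.mpr ⟨by simpa [huw.ne', hwc] using hwL,
        List.nodup_cons.mpr ⟨by simpa [hu.ne'] using huL, hcN⟩⟩)
      rfl t hwt
    have ht' : t ∈ d :: L := by simpa [htu, htc] using ht
    exact (hL t ht').trans
      ((hH t w hwt.symm (hdne t ht').1 (hdne t ht').2.2 hwa hwc).reachable.trans hwu.reachable)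
  have hb : H.Reachable d b := by
    obtain ⟨t, hbt, hta, htc⟩ := hthird b a c
    exact (hB t hta htc hbt).trans
      (hH t b hbt.symm hta htc hab.ne' hbc.ne).reachable
  have hstep : ∀ w u, H.Reachable d w → G.Adj w u → H.Reachable d u := by
    intro w u hw hwu
    by_cases hub : u = b
    · exact hub ▸ hb
    by_cases hua : u = a
    · exact hua ▸ hb.trans hHab.symm.reachable
    by_cases huc : u = c
    · exact huc ▸ hb.trans hHbc.reachable
    by_cases hwa : w = a
    · exact hL u (hA u hub huc (hwa ▸ hwu))
    by_cases hwc : w = c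
    · exact hC u hua hub (hwc ▸ hwu)
    exact hw.trans (hH w u hwu hwa hwc hua huc).reachable
  rw [connected_iff_exists_forall_reachable]
  refine ⟨d, fun w ↦ ?_⟩
  have := hconn.preconnected d w
  rw [reachable_iff_reflTransGen] at this
  induction this with
  | refl => rfl
  | tail _ h ih => exact hstep _ _ ih h

/-- Connected cubic bipartite graphs have an anti-Kekulé set with four edges. -/
lemma exists_isAntiKekuleSet_card_eq_four {V : Type*} [Fintype V] [DecidableEq V]
    (G : SimpleGraph V) [DecidableRel G.Adj]
    (hconn : G.Connected) (hbip : G.Colorable 2)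
    (hcubic : ∀ v : V, G.degree v = 3) :
    ∃ S : Finset (Sym2 V), IsAntiKekuleSet G S ∧ S.card = 4 := by
  obtain ⟨a, b, c, hab, hbc, hac, hH⟩ := exists_connected_of_two_pendant_vertices G hconn hcubic
  have hnadj : ¬ G.Adj a c := by
    intro h
    let C := hbip.some
    have h₁ := C.valid hab
    have h₂ := C.valid hbc
    have h₃ := C.valid h
    lia
  let S : Finset (Sym2 V) := ((G.neighborFinset a).erase b).image (fun w ↦ s(a, w)) ∪
    ((G.neighborFinset c).erase b).image (fun w ↦ s(c, w))
  have memS : ∀ e, e ∈ S ↔ (∃ w, w ≠ b ∧ G.Adj a w ∧ s(a, w) = e) ∨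
      ∃ w, w ≠ b ∧ G.Adj c w ∧ s(c, w) = e := by
    intro e
    simp [S, and_assoc]
  have haS : ∀ w, (G.deleteEdges (↑S : Set (Sym2 V))).Adj a w → w = b := by
    intro w hw
    rw [deleteEdges_adj] at hw
    by_contra hwb
    exact hw.2 (Finset.mem_coe.mpr ((memS _).mpr (Or.inl ⟨w, hwb, hw.1, rfl⟩)))
  have hcS : ∀ w, (G.deleteEdges (↑S : Set (Sym2 V))).Adj c w → w = b := by
    intro w hw
    rw [deleteEdges_adj] at hw
    by_contra hwb
    exact hw.2 (Finset.mem_coe.mpr ((memS _).mpr (Or.inr ⟨w, hwb, hw.1, rfl⟩)))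
  refine ⟨S, ⟨?_, ?_, ?_⟩, ?_⟩
  · intro e he
    rcases (memS e).mp he with ⟨w, -, h, rfl⟩ | ⟨w, -, h, rfl⟩ <;> exact h
  · apply hH
    · rw [deleteEdges_adj, Finset.mem_coe, memS]
      refine ⟨hab, ?_⟩
      rintro (⟨w, hw, -, h⟩ | ⟨w, hw, -, h⟩) <;> rw [Sym2.eq_iff] at h <;> grind
    · rw [deleteEdges_adj, Finset.mem_coe, memS]
      refine ⟨hbc, ?_⟩
      rintro (⟨w, hw, -, h⟩ | ⟨w, hw, -, h⟩) <;> rw [Sym2.eq_iff] at h <;> grind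
    · intro u v huv hua huc hva hvc
      rw [deleteEdges_adj, Finset.mem_coe, memS]
      refine ⟨huv, ?_⟩
      rintro (⟨w, hw, -, h⟩ | ⟨w, hw, -, h⟩) <;> rw [Sym2.eq_iff] at h <;> grind
  · rintro ⟨M, hM, hspan⟩
    obtain ⟨x, hx, -⟩ := hM (hspan a)
    obtain ⟨y, hy, -⟩ := hM (hspan c)
    obtain rfl := haS x hx.adj_sub
    obtain rfl := hcS y hy.adj_sub
    exact hac ((hM (hspan y)).unique hx.symm hy.symm)
  · rw [Finset.card_union_of_disjoint, Finset.card_image_of_injective,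
      Finset.card_image_of_injective, Finset.card_erase_of_mem, Finset.card_erase_of_mem,
      card_neighborFinset_eq_degree, card_neighborFinset_eq_degree, hcubic, hcubic]
    · simpa using hbc.symm
    · simpa using hab
    · intro x y h
      exact Sym2.congr_right.mp h
    · intro x y h
      exact Sym2.congr_right.mp h
    · rw [Finset.disjoint_left]
      simp only [Finset.mem_image, Finset.mem_erase, mem_neighborFinset]
      rintro e ⟨w, ⟨-, hw⟩, rfl⟩ ⟨w', ⟨-, hw'⟩, h⟩
      rw [Sym2.eq_iff] at h
      grind

/-- If `G` is a finite connected cubic bipartite graph, then `ak(G) = 4`: there is an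
anti-Kekulé set with exactly 4 edges, and every anti-Kekulé set has at least 4 edges. -/
theorem antiKekule_cubic_bipartite {V : Type*} [Fintype V] [DecidableEq V]
    (G : SimpleGraph V) [DecidableRel G.Adj]
    (hconn : G.Connected) (hbip : G.Colorable 2)
    (hcubic : ∀ v : V, G.degree v = 3) :
    (∃ S : Finset (Sym2 V), IsAntiKekuleSet G S ∧ S.card = 4) ∧
      (∀ S : Finset (Sym2 V), IsAntiKekuleSet G S → 4 ≤ S.card) := by
  refine ⟨exists_isAntiKekuleSet_card_eq_four G hconn hbip hcubic, fun S hS ↦ ?_⟩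
  by_contra! h
  exact hS.2.2 (exists_isPerfectMatching_deleteEdges_of_card_le_three G hbip hcubic S (by lia)
    hS.2.1)
end

section
/- If G is a finite connected cubic bipartite graph, then every anti-Kekulé set of G contains at least 4 edges; that is, for every edge set S ⊆ E(G) with |S| ≤ 3 such that G − S is connected, the graph G − S has a perfect matching. -/
open SimpleGraph

namespace SimpleGraph

variable {V : Type*} {G H : SimpleGraph V}

lemma card_sigma_neighborFinset [Fintype V] [DecidableRel G.Adj] {d : ℕ} (hd : ∀ v, G.degree v = d)
    (s : Finset V) : (s.sigma fun v => G.neighborFinset v).card = d * s.card := by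
  simp [Finset.card_sigma, hd, mul_comm]

/-- A nonempty vertex set that is closed under adjacency in a connected graph is everything. -/
lemma Connected.mem_of_forall_adj (hH : H.Connected) {p : V → Prop} {a : V} (ha : p a)
    (hp : ∀ x y, H.Adj x y → p x → p y) (b : V) : p b := by
  obtain ⟨w⟩ := hH.preconnected a b
  induction w with
  | nil => exact ha
  | cons h _ ih => exact ih (hp _ _ h ha)

/-- Hall's condition, for sets inside one colour class, in a connected graph obtained from a
bipartite `d`-regular graph by deleting at most `d` edges. -/
lemma card_le_card_biUnion_neighborFinset_deleteEdges [Fintype V] [DecidableEq V]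
    [DecidableRel G.Adj] {d : ℕ} (hd0 : 0 < d)
    (hd : ∀ v, G.degree v = d) (c : G.Coloring (Fin 2)) (S : Finset (Sym2 V)) (hcard : S.card ≤ d)
    [DecidableRel (G.deleteEdges (S : Set (Sym2 V))).Adj]
    (hconn : (G.deleteEdges (S : Set (Sym2 V))).Connected)
    (i : Fin 2) (s : Finset V) (hs : ∀ v ∈ s, c v = i) :
    s.card ≤ (s.biUnion fun v => (G.deleteEdges (S : Set (Sym2 V))).neighborFinset v).card := by
  set T := s.biUnion fun v => (G.deleteEdges (S : Set (Sym2 V))).neighborFinset v with hT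
  have memT : ∀ x y, x ∈ s → G.Adj x y → s(x, y) ∉ S → y ∈ T := fun x y hx hxy h =>
    Finset.mem_biUnion.2 ⟨x, hx, by simp [deleteEdges_adj, hxy, h]⟩
  by_contra! hlt
  let D := s.sigma fun v => G.neighborFinset v
  let E := T.sigma fun v => G.neighborFinset v
  let swap : (Σ _ : V, V) → (Σ _ : V, V) := fun p => ⟨p.2, p.1⟩
  have swap_inj : Function.Injective swap := by
    rintro ⟨a, b⟩ ⟨a', b'⟩ h
    simp only [swap, Sigma.mk.injEq, heq_eq_eq] at h ⊢
    exact h.symm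
  have hD : D.card = d * s.card := card_sigma_neighborFinset hd s
  have hE : E.card = d * T.card := card_sigma_neighborFinset hd T
  have hsub : (D.filter fun p => p.2 ∈ T).image swap ⊆ E := by
    intro q hq
    obtain ⟨⟨x, y⟩, hp, rfl⟩ := Finset.mem_image.1 hq
    simp only [D, E, swap, Finset.mem_filter, Finset.mem_sigma, mem_neighborFinset] at hp ⊢
    exact ⟨hp.2, hp.1.2.symm⟩
  have hin : ((D.filter fun p => p.2 ∈ T).image swap).card = (D.filter fun p => p.2 ∈ T).card :=
    Finset.card_image_of_injective _ swap_inj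
  have hout : (D.filter fun p => p.2 ∉ T).card ≤ S.card := by
    refine Finset.card_le_card_of_injOn (fun p => s(p.1, p.2)) ?_ ?_
    · rintro ⟨x, y⟩ hp
      simp only [D, Finset.coe_filter, Set.mem_ofPred_eq, Finset.mem_sigma,
        mem_neighborFinset] at hp
      by_contra h
      exact hp.2 (memT x y hp.1.1 hp.1.2 h)
    · rintro ⟨x, y⟩ hp ⟨x', y'⟩ hp' h
      simp only [D, Finset.coe_filter, Set.mem_ofPred_eq, Finset.mem_sigma,
        mem_neighborFinset] at hp hp'
      rcases Sym2.eq_iff.1 h with ⟨h₁, h₂⟩ | ⟨h₁, h₂⟩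
      · simp only at h₁ h₂
        rw [h₁, h₂]
      · simp only at h₁ h₂
        subst h₁ h₂
        exact absurd ((hs _ hp.1.1).trans (hs _ hp'.1.1).symm) (c.valid hp.1.2)
  have hsplit : (D.filter fun p => p.2 ∈ T).card + (D.filter fun p => p.2 ∉ T).card = D.card :=
    Finset.card_filter_add_card_filter_not _
  have hmul : d * T.card + d ≤ d * s.card := by
    calc d * T.card + d = d * (T.card + 1) := by ring
      _ ≤ d * s.card := Nat.mul_le_mul_left d hlt
  have heq : (D.filter fun p => p.2 ∈ T).image swap = E :=
    Finset.eq_of_subset_of_card_le hsub (by lia)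
  have hback : ∀ x y, y ∈ T → G.Adj y x → x ∈ s := by
    intro x y hy hyx
    have hmem : (⟨y, x⟩ : Σ _ : V, V) ∈ (D.filter fun p => p.2 ∈ T).image swap := by
      rw [heq]
      simp [E, hy, hyx]
    obtain ⟨⟨a, b⟩, hp, h⟩ := Finset.mem_image.1 hmem
    simp only [swap, Sigma.mk.injEq, heq_eq_eq] at h
    simp only [D, Finset.mem_filter, Finset.mem_sigma] at hp
    exact h.2 ▸ hp.1.1
  obtain ⟨a, ha⟩ : s.Nonempty := Finset.card_pos.1 (by lia)
  have hall : ∀ v, v ∈ s ∨ v ∈ T := by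
    refine hconn.mem_of_forall_adj (p := fun v => v ∈ s ∨ v ∈ T) (Or.inl ha) ?_
    intro x y hxy hx
    have hxy' := deleteEdges_adj.1 hxy
    rcases hx with hx | hx
    · exact Or.inr (memT x y hx hxy'.1 hxy'.2)
    · exact Or.inl (hback y x hx hxy'.1)
  have hempty : (D.filter fun p => p.2 ∉ T) = ∅ := by
    refine Finset.filter_eq_empty_iff.2 ?_
    rintro ⟨x, y⟩ hp
    simp only [D, Finset.mem_sigma, mem_neighborFinset] at hp
    rcases hall y with hy | hy
    · exact absurd ((hs _ hp.1).trans (hs _ hy).symm) (c.valid hp.2)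
    · simpa using hy
  rw [hempty, Finset.card_empty] at hsplit
  rw [heq] at hin
  lia

/-- In a bipartite graph, Hall's condition for sets inside one colour class implies it for
all sets. -/
lemma card_le_card_biUnion_neighborFinset_of_coloring [Fintype V] [DecidableEq V]
    [DecidableRel H.Adj]
    (c : H.Coloring (Fin 2))
    (h : ∀ (i : Fin 2) (s : Finset V), (∀ v ∈ s, c v = i) →
      s.card ≤ (s.biUnion fun v => H.neighborFinset v).card) (s : Finset V) :
    s.card ≤ (s.biUnion fun v => H.neighborFinset v).card := by
  have h₀ := h 0 (s.filter fun v => c v = 0) (by simp)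
  have h₁ := h 1 (s.filter fun v => ¬ c v = 0) (by
    intro v hv
    have := (Finset.mem_filter.1 hv).2
    lia)
  have hdisj : Disjoint ((s.filter fun v => c v = 0).biUnion fun v => H.neighborFinset v)
      ((s.filter fun v => ¬ c v = 0).biUnion fun v => H.neighborFinset v) := by
    refine Finset.disjoint_left.2 fun y hy hy' => ?_
    simp only [Finset.mem_biUnion, Finset.mem_filter, mem_neighborFinset] at hy hy'
    obtain ⟨x, ⟨-, hx⟩, hxy⟩ := hy
    obtain ⟨x', ⟨-, hx'⟩, hxy'⟩ := hy'
    have := c.valid hxy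
    have := c.valid hxy'
    lia
  have hunion : ((s.filter fun v => c v = 0).biUnion fun v => H.neighborFinset v) ∪
      ((s.filter fun v => ¬ c v = 0).biUnion fun v => H.neighborFinset v) =
      s.biUnion fun v => H.neighborFinset v := by
    rw [← Finset.union_biUnion, Finset.filter_union_filter_not_eq]
  rw [← hunion, Finset.card_union_of_disjoint hdisj,
    ← Finset.card_filter_add_card_filter_not (s := s) fun v => c v = 0]
  exact add_le_add h₀ h₁

end SimpleGraph

/-- If `G` is a finite connected cubic bipartite graph, then every anti-Kekulé set of `G`
has at least 4 edges: for every edge set `S` with `|S| ≤ 3` such that `G - S` is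
connected, `G - S` has a perfect matching. -/
theorem antiKekule_lower_bound_cubic_bipartite {V : Type*} [Fintype V] [DecidableEq V]
    (G : SimpleGraph V) [DecidableRel G.Adj]
    (hconn : G.Connected) (hbip : G.Colorable 2)
    (hcubic : ∀ v : V, G.degree v = 3)
    (S : Finset (Sym2 V)) (hS : ↑S ⊆ G.edgeSet) (hcard : S.card ≤ 3)
    (hconn' : (G.deleteEdges ↑S).Connected) :
    ∃ M : (G.deleteEdges ↑S).Subgraph, M.IsPerfectMatching := by
  classical
  obtain ⟨c⟩ := hbip
  let c' : (G.deleteEdges (S : Set (Sym2 V))).Coloring (Fin 2) :=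
    Coloring.mk c fun h => c.valid (deleteEdges_adj.1 h).1
  have hbw : (G.deleteEdges (S : Set (Sym2 V))).IsBipartiteWith {v | c' v = 0} {v | c' v = 1} := by
    refine ⟨Set.disjoint_left.2 fun v hv hv' => ?_, fun x y h => ?_⟩
    · simp only [Set.mem_ofPred_eq] at hv hv'
      lia
    · have := c'.valid h
      simp only [Set.mem_ofPred_eq]
      lia
  refine exists_isPerfectMatching_of_forall_ncard_le hbw fun s => ?_
  have key := card_le_card_biUnion_neighborFinset_of_coloring c'
    (card_le_card_biUnion_neighborFinset_deleteEdges (by norm_num) hcubic c S hcard hconn')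
    s.toFinset
  have hN : (⋃ x ∈ s, (G.deleteEdges (S : Set (Sym2 V))).neighborSet x) =
      ((s.toFinset.biUnion fun v => (G.deleteEdges (S : Set (Sym2 V))).neighborFinset v :
        Finset V) : Set V) := by
    ext
    simp
  rwa [hN, Set.ncard_coe_finset, Set.ncard_eq_toFinset_card']
end

section
/- If G is a finite connected cubic graph containing a bridge (an edge whose deletion disconnects G), then the anti-Kekulé number of G is at most 2; that is, there exists an edge set S ⊆ E(G) with |S| ≤ 2 such that G − S is connected and G − S has no perfect matching. -/
open SimpleGraph

namespace SimpleGraph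

variable {V : Type*} {G : SimpleGraph V}

/-- The edge `uv` is the only edge of `G` between the vertex set `A` and its complement,
and it leaves `A` at `u`. -/
def IsUniqueExit (G : SimpleGraph V) (A : Finset V) (u v : V) : Prop :=
  u ∈ A ∧ v ∉ A ∧ G.Adj u v ∧ ∀ a ∈ A, ∀ b ∉ A, G.Adj a b → a = u ∧ b = v

lemma Preconnected.exists_adj_mem_notMem (hG : G.Preconnected) {A : Finset V} {a b : V}
    (ha : a ∈ A) (hb : b ∉ A) : ∃ c ∈ A, ∃ d ∉ A, G.Adj c d := by
  obtain ⟨p⟩ := hG a b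
  obtain ⟨d, -, h₁, h₂⟩ := p.exists_boundary_dart (A : Set V) (by simpa using ha)
    (by simpa using hb)
  exact ⟨d.fst, by simpa using h₁, d.snd, by simpa using h₂, d.adj⟩

lemma IsBridge.exists_isUniqueExit [Fintype V] {e : Sym2 V} (he : G.IsBridge e)
    (hG : G.Preconnected) : ∃ A u v, G.IsUniqueExit A u v := by
  classical
  induction e with | _ u v
  have hadj : G.Adj u v := he.reachable_iff_adj.1 (hG u v)
  rw [isBridge_iff] at he
  refine ⟨({w | (G.deleteEdges {s(u, v)}).Reachable u w} : Finset V), u, v, by simp,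
    by simpa using he, hadj, fun a ha b hb hab ↦ ?_⟩
  simp only [Finset.mem_filter_univ] at ha hb
  have hs : s(a, b) = s(u, v) := by
    by_contra hne
    exact hb (ha.trans (Adj.reachable
      (by simpa [deleteEdges_adj] using ⟨hab, by simpa using hne⟩)))
  rcases Sym2.eq_iff.1 hs with h | ⟨rfl, -⟩
  · exact h
  · exact absurd ha he

/-- In a graph all of whose vertices have degree 3, a vertex set that is left by exactly one edge
has odd cardinality. -/
lemma IsUniqueExit.odd_card [Fintype V] [DecidableEq V] [DecidableRel G.Adj] {A : Finset V}
    {u v : V} (h : G.IsUniqueExit A u v) (hG : G.IsRegularOfDegree 3) : Odd A.card := by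
  obtain ⟨hu, hv, hadj, hcut⟩ := h
  have hin : ((∑ d ∈ (A ×ˢ A).filter (fun d ↦ G.Adj d.1 d.2), 1 : ℕ) : ZMod 2) = 0 := by
    push_cast
    refine Finset.sum_involution (fun d _ ↦ d.swap) (fun _ _ ↦ by decide) ?_ ?_ ?_
    · rintro ⟨a, b⟩ hd - heq
      simp only [Finset.mem_filter, Prod.swap_prod_mk, Prod.mk.injEq] at hd heq
      exact hd.2.ne heq.2
    · rintro ⟨a, b⟩ hd
      simp only [Finset.mem_filter, Finset.mem_product, Prod.swap_prod_mk] at hd ⊢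
      exact ⟨hd.1.symm, hd.2.symm⟩
    · simp
  have hall : ((A ×ˢ Finset.univ).filter (fun d ↦ G.Adj d.1 d.2)).card = 3 * A.card := by
    rw [Finset.card_filter, Finset.sum_product, mul_comm]
    refine (Finset.sum_congr rfl fun a _ ↦ ?_).trans (by simp : ∑ _a ∈ A, 3 = A.card * 3)
    rw [← Finset.card_filter, ← hG.degree_eq a, ← card_neighborFinset_eq_degree,
      neighborFinset_eq_filter]
  have hsplit : (A ×ˢ Finset.univ).filter (fun d ↦ G.Adj d.1 d.2) =
      insert (u, v) ((A ×ˢ A).filter (fun d ↦ G.Adj d.1 d.2)) := by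
    ext ⟨a, b⟩
    simp only [Finset.mem_filter, Finset.mem_product, Finset.mem_univ, Finset.mem_insert,
      Prod.mk.injEq]
    grind
  rw [hsplit, Finset.card_insert_of_notMem (by simp [hv]), Finset.card_eq_sum_ones] at hall
  rw [ZMod.natCast_eq_zero_iff_even] at hin
  grind

/-- If no edge of a perfect matching leaves `A`, then `A` has even cardinality. -/
lemma Subgraph.IsPerfectMatching.even_card_of_adj_closed {M : G.Subgraph} (hM : M.IsPerfectMatching)
    {A : Finset V} (hA : ∀ a ∈ A, ∀ b, M.Adj a b → b ∈ A) : Even A.card := by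
  choose f hf hf' using Subgraph.isPerfectMatching_iff.1 hM
  rw [← ZMod.natCast_eq_zero_iff_even, Finset.card_eq_sum_ones]
  push_cast
  exact Finset.sum_involution (fun a _ ↦ f a) (fun _ _ ↦ by decide)
    (fun a _ _ h ↦ (hf a).ne h.symm) (fun a ha ↦ hA a ha _ (hf a))
    (fun a _ ↦ (hf' _ _ (hf a).symm).symm)

/-- Let `A` be a minimal vertex set left by exactly one edge `uv`, and let `x ∈ A` have
neighbors `u`, `p`, `q`. Deleting `xp` and `xq` keeps the graph connected. -/
lemma IsUniqueExit.connected_deleteEdges [Fintype V] [DecidableEq V] {A : Finset V} {u v x p q : V}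
    (h : G.IsUniqueExit A u v)
    (hmin : ∀ B ⊂ A, ∀ a b, ¬ G.IsUniqueExit B a b) (hG : G.Connected) (hxA : x ∈ A)
    (hpu : p ≠ u) (hqu : q ≠ u) (hx : ∀ w, G.Adj x w ↔ w = u ∨ w = p ∨ w = q) :
    (G.deleteEdges {s(x, p), s(x, q)}).Connected := by
  classical
  obtain ⟨hu, hv, hadj, hcut⟩ := h
  have hxu : G.Adj x u := (hx u).2 (by simp)
  have hxp : G.Adj x p := (hx p).2 (by simp)
  have hxq : G.Adj x q := (hx q).2 (by simp)
  have hpA : p ∈ A := by_contra fun hp ↦ hxu.ne (hcut x hxA p hp hxp).1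
  have hqA : q ∈ A := by_contra fun hq ↦ hxu.ne (hcut x hxA q hq hxq).1
  set H := G.deleteEdges {s(x, p), s(x, q)} with hH
  rw [connected_iff_exists_forall_reachable]
  refine ⟨u, fun w ↦ by_contra fun hw ↦ ?_⟩
  let C : Finset V := {w | ¬ H.Reachable u w}
  have hC : ∀ {w}, w ∈ C ↔ ¬ H.Reachable u w := by simp [C]
  have huC : u ∉ C := fun h ↦ hC.1 h (Reachable.refl u)
  have hxC : x ∉ C := by
    refine fun h ↦ hC.1 h (Adj.reachable ?_)
    simp only [hH, deleteEdges_adj, Set.mem_insert_iff, Set.mem_singleton_iff, Sym2.eq_iff]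
    exact ⟨hxu.symm, by grind⟩
  have hbdry : ∀ a ∈ C, ∀ b ∉ C, G.Adj a b → b = x ∧ (a = p ∨ a = q) := by
    intro a ha b hb hab
    by_cases hs : s(a, b) ∈ ({s(x, p), s(x, q)} : Set (Sym2 V))
    · simp only [Set.mem_insert_iff, Set.mem_singleton_iff, Sym2.eq_iff] at hs
      grind
    · refine absurd ?_ (hC.1 ha)
      exact (not_not.1 (mt hC.2 hb)).trans (Adj.reachable (deleteEdges_adj.2 ⟨hab, hs⟩)).symm
  have hCA : C ⊆ A := by
    by_contra hne
    obtain ⟨c, hc, hcA⟩ := Finset.not_subset.1 hne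
    obtain ⟨a, ha, b, hb, hab⟩ := hG.preconnected.exists_adj_mem_notMem (A := C \ A) (b := u)
      (Finset.mem_sdiff.2 ⟨hc, hcA⟩) (by simp [huC])
    rw [Finset.mem_sdiff] at ha hb
    by_cases hbC : b ∈ C
    · have hbA : b ∈ A := by_contra fun hbA ↦ hb ⟨hbC, hbA⟩
      exact huC ((hcut b hbA a ha.2 hab.symm).1 ▸ hbC)
    · rcases (hbdry a ha.1 b hbC hab).2 with rfl | rfl
      exacts [ha.2 hpA, ha.2 hqA]
  have hCss : C ⊂ A := (Finset.ssubset_iff_of_subset hCA).2 ⟨u, hu, huC⟩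
  by_cases hboth : p ∈ C ∧ q ∈ C
  · refine hmin (insert x C) ((Finset.ssubset_iff_of_subset ?_).2 ⟨u, hu, ?_⟩) x u
      ⟨by simp, ?_, hxu, fun a ha b hb hab ↦ ?_⟩
    · exact Finset.insert_subset hxA hCA
    · simp [huC, hxu.ne']
    · simp [huC, hxu.ne']
    · rw [Finset.mem_insert] at ha hb
      grind
  · obtain ⟨a, ha, b, hb, hab⟩ := hG.preconnected.exists_adj_mem_notMem (hC.2 hw) huC
    obtain ⟨rfl, h⟩ := hbdry a ha b hb hab
    refine hmin C hCss a b ⟨ha, hb, hab, fun c hc d hd hcd ↦ ?_⟩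
    obtain ⟨rfl, h'⟩ := hbdry c hc d hd hcd
    grind

end SimpleGraph

/-- If `G` is a finite connected cubic graph with a bridge, then `ak(G) ≤ 2`: there is an
edge set `S` with `|S| ≤ 2` such that `G - S` is connected and has no perfect matching. -/
theorem antiKekule_cubic_with_bridge {V : Type*} [Fintype V] [DecidableEq V]
    (G : SimpleGraph V) [DecidableRel G.Adj]
    (hconn : G.Connected) (hcubic : ∀ v : V, G.degree v = 3)
    (e : Sym2 V) (he : G.IsBridge e) :
    ∃ S : Finset (Sym2 V), ↑S ⊆ G.edgeSet ∧ S.card ≤ 2 ∧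
      (G.deleteEdges ↑S).Connected ∧
      ¬ ∃ M : (G.deleteEdges ↑S).Subgraph, M.IsPerfectMatching := by
  obtain ⟨A, ⟨u, v, hA⟩, hmin⟩ := exists_minimal_of_wellFoundedLT
    (fun A : Finset V ↦ ∃ u v, G.IsUniqueExit A u v) (he.exists_isUniqueExit hconn.preconnected)
  obtain ⟨hu, -, -, hcut⟩ := id hA
  obtain ⟨x, hx, hxv⟩ : ∃ x ∈ G.neighborFinset u, x ≠ v :=
    Finset.exists_mem_ne (by simp [hcubic]) v
  rw [mem_neighborFinset] at hx
  have hxA : x ∈ A := by_contra fun h ↦ hxv (hcut u hu x h hx).2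
  obtain ⟨p, q, -, hpqx⟩ : ∃ p q, p ≠ q ∧ (G.neighborFinset x).erase u = {p, q} := by
    rw [← Finset.card_eq_two, Finset.card_erase_of_mem (by simpa using hx.symm)]
    simp [hcubic]
  have hmem : ∀ w, (w ≠ u ∧ G.Adj x w) ↔ w = p ∨ w = q := fun w ↦ by
    simpa using congrArg (w ∈ ·) hpqx
  have hp := (hmem p).2 (by simp)
  have hq := (hmem q).2 (by simp)
  have hnbr : ∀ w, G.Adj x w ↔ w = u ∨ w = p ∨ w = q := fun w ↦ by
    have := hx.symm
    grind
  refine ⟨{s(x, p), s(x, q)}, ?_, Finset.card_le_two, ?_, ?_⟩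
  · simp [Set.insert_subset_iff, hp.2, hq.2]
  · rw [Finset.coe_pair]
    refine hA.connected_deleteEdges (fun B hB a b h ↦ ?_) hconn hxA hp.1 hq.1 hnbr
    exact hB.not_subset (hmin ⟨a, b, h⟩ hB.subset)
  · rintro ⟨M, hM⟩
    have hM' := Subgraph.isPerfectMatching_iff.1 hM
    have hxM : ∀ w, M.Adj x w → w = u := by
      intro w hw
      have hw' := deleteEdges_adj.1 hw.adj_sub
      have := (hnbr w).1 hw'.1
      have := hw'.2
      grind
    have huM : M.Adj u x := by
      obtain ⟨w, hw, -⟩ := hM' x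
      exact (hxM w hw ▸ hw).symm
    refine Nat.not_even_iff_odd.2 (hA.odd_card hcubic)
      (hM.even_card_of_adj_closed fun a ha b hab ↦ ?_)
    by_contra hb
    obtain ⟨rfl, rfl⟩ := hcut a ha b hb (deleteEdges_adj.1 hab.adj_sub).1
    exact hxv ((hM' a).unique huM hab)
end

section
/- Every perfect matching of a finite connected cubic simple graph contains every bridge of the graph; that is, if G is a finite connected cubic graph, M is a perfect matching of G, and e is a bridge of G, then e ∈ M. -/
open SimpleGraph

/-- Removing a perfect matching from a cubic graph leaves a disjoint union of cycles. -/
theorem SimpleGraph.isCycles_sdiff_of_isPerfectMatching {V : Type*} [Fintype V]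
    {G : SimpleGraph V} [DecidableRel G.Adj] (hcubic : ∀ v : V, G.degree v = 3)
    {M : G.Subgraph} (hM : M.IsPerfectMatching) : (G \ M.spanningCoe).IsCycles := by
  intro v _
  obtain ⟨w, hw, hunique⟩ := Subgraph.isPerfectMatching_iff.mp hM v
  have hset : (G \ M.spanningCoe).neighborSet v = G.neighborSet v \ {w} := by
    ext x
    simp only [mem_neighborSet, sdiff_adj, Subgraph.spanningCoe_adj, Set.mem_sdiff,
      Set.mem_singleton_iff]
    exact and_congr_right fun _ => not_congr ⟨hunique x, fun h => h ▸ hw⟩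
  have hcard : (G.neighborSet v).ncard = 3 := by
    rw [← hcubic v, ← card_neighborSet_eq_degree, Set.ncard_eq_toFinset_card',
      Set.toFinset_card]
  have hmem : w ∈ G.neighborSet v := M.adj_sub hw
  rw [hset, Set.ncard_sdiff_singleton_of_mem hmem, hcard]

/-- Every perfect matching of a finite connected cubic graph contains every bridge. -/
theorem bridge_mem_perfectMatching {V : Type*} [Fintype V] [DecidableEq V]
    (G : SimpleGraph V) [DecidableRel G.Adj]
    (hconn : G.Connected) (hcubic : ∀ v : V, G.degree v = 3)
    (M : G.Subgraph) (hM : M.IsPerfectMatching)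
    (e : Sym2 V) (he : G.IsBridge e) :
    e ∈ M.edgeSet := by
  induction e with | h u v
  by_contra hnot
  have hadj : (G \ M.spanningCoe).Adj u v :=
    ⟨he.reachable_iff_adj.mp (hconn u v), hnot⟩
  exact he <| ((isCycles_sdiff_of_isPerfectMatching hcubic hM).reachable_deleteEdges hadj).mono
    (deleteEdges_mono sdiff_le)
end

section
/- Let G be a finite simple graph with no perfect matching, and let S ⊆ V(G) be a vertex set of maximum cardinality among all sets U satisfying c_o(G − U) > |U| (such sets exist by Tutte's theorem, taking for example U = ∅ if necessary after parity considerations). Then G − S has no connected component with an even number of vertices; every component of G − S has odd order. -/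
open SimpleGraph

/-- The number of odd connected components of `G - U` (the subgraph of `G` induced on the
complement of the vertex set `U`). -/
noncomputable def oddComponentsCount {V : Type*} [Fintype V] (G : SimpleGraph V)
    (U : Set V) : ℕ :=
  Nat.card {c : (G.induce Uᶜ).ConnectedComponent // Odd c.supp.ncard}

/-- A component of `G[A]` contained in `B ⊆ A` is also a component of `G[B]`. -/
theorem SimpleGraph.ConnectedComponent.exists_image_supp_eq_of_subset {V : Type*}
    {G : SimpleGraph V} {A B : Set V} (hBA : B ⊆ A) (K : (G.induce A).ConnectedComponent)
    (hK : Subtype.val '' K.supp ⊆ B) :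
    ∃ L : (G.induce B).ConnectedComponent, Subtype.val '' L.supp = Subtype.val '' K.supp := by
  have hmem {x : A} (hx : (G.induce A).connectedComponentMk x = K) : (x : V) ∈ B :=
    hK ⟨x, hx, rfl⟩
  have lift {x y : A} (p : (G.induce A).Walk x y)
      (hx : (G.induce A).connectedComponentMk x = K)
      (hy : (G.induce A).connectedComponentMk y = K) :
      (G.induce B).Reachable ⟨x, hmem hx⟩ ⟨y, hmem hy⟩ := by
    induction p with
    | nil => rfl
    | @cons u w _ h p ih =>
      have hw : (G.induce A).connectedComponentMk w = K :=
        (ConnectedComponent.sound h.reachable.symm).trans hx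
      have huw : (G.induce B).Adj ⟨u, hmem hx⟩ ⟨w, hmem hw⟩ := h
      exact huw.reachable.trans (ih hw hy)
  obtain ⟨x, hx⟩ := K.nonempty_supp
  refine ⟨(G.induce B).connectedComponentMk ⟨x, hmem hx⟩, Set.Subset.antisymm ?_ ?_⟩
  · rintro _ ⟨y, hy, rfl⟩
    refine ⟨⟨y, hBA y.2⟩, ?_, rfl⟩
    have hr := (ConnectedComponent.exact hy).map (induceHomOfLE G hBA).toHom
    exact (ConnectedComponent.sound hr).trans hx
  · rintro _ ⟨y, hy, rfl⟩
    obtain ⟨p⟩ := ConnectedComponent.exact (hy.trans hx.symm)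
    exact ⟨⟨y, hmem hy⟩, ConnectedComponent.sound (lift p hy hx), rfl⟩

/-- Deleting further vertices that lie outside all odd components does not decrease the number of
odd components. -/
theorem oddComponentsCount_le_of_subset {V : Type*} [Fintype V] {G : SimpleGraph V} {S U : Set V}
    (hSU : S ⊆ U)
    (h : ∀ K : (G.induce Sᶜ).ConnectedComponent, Odd K.supp.ncard →
      Subtype.val '' K.supp ⊆ Uᶜ) :
    oddComponentsCount G S ≤ oddComponentsCount G U := by
  choose f hf using fun K : {K : (G.induce Sᶜ).ConnectedComponent // Odd K.supp.ncard} ↦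
    K.1.exists_image_supp_eq_of_subset (Set.compl_subset_compl.mpr hSU) (h K.1 K.2)
  have hodd (K) : Odd (f K).supp.ncard := by
    rw [← Set.ncard_image_of_injective _ Subtype.val_injective, hf K,
      Set.ncard_image_of_injective _ Subtype.val_injective]
    exact K.2
  refine Nat.card_le_card_of_injective (fun K ↦ ⟨f K, hodd K⟩) fun K L hKL ↦ ?_
  have hfKL : f K = f L := congrArg Subtype.val hKL
  refine Subtype.ext (ConnectedComponent.supp_injective ?_)
  exact Subtype.val_injective.image_injective ((hf K).symm.trans (hfKL ▸ hf L))

theorem odd_oddComponentsCount_iff {V : Type*} [Fintype V] (G : SimpleGraph V) (U : Set V) :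
    Odd (oddComponentsCount G U) ↔ Odd Uᶜ.ncard :=
  odd_ncard_oddComponents (G.induce Uᶜ)

/-- Let `G` be a finite graph with no perfect matching and let `S` be a vertex set of
maximum cardinality among all sets `U` with `c_o(G - U) > |U|`. Then every connected
component of `G - S` has an odd number of vertices (there are no even components). -/
theorem maximal_tutte_set_no_even_components {V : Type*} [Fintype V] [DecidableEq V]
    (G : SimpleGraph V)
    (hnpm : ¬ ∃ M : G.Subgraph, M.IsPerfectMatching)
    (S : Set V) (hS : S.ncard < oddComponentsCount G S)
    (hmax : ∀ U : Set V, U.ncard < oddComponentsCount G U → U.ncard ≤ S.ncard) :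
    ∀ c : (G.induce Sᶜ).ConnectedComponent, Odd c.supp.ncard := by
  intro c
  by_contra hc
  obtain ⟨v, hv⟩ := c.nonempty_supp
  have hvS : (v : V) ∉ S := v.2
  have hcard : (insert (v : V) S).ncard = S.ncard + 1 := Set.ncard_insert_of_notMem hvS
  have hle : oddComponentsCount G S ≤ oddComponentsCount G (insert (v : V) S) := by
    refine oddComponentsCount_le_of_subset (Set.subset_insert _ _) fun K hK ↦ ?_
    rintro _ ⟨x, hx, rfl⟩ (hxv | hxS)
    · obtain rfl : x = v := Subtype.ext hxv
      exact hc (hx.symm.trans hv ▸ hK)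
    · exact x.2 hxS
  have hpS := odd_oddComponentsCount_iff G S
  have hpU := odd_oddComponentsCount_iff G (insert (v : V) S)
  have hS' := Set.ncard_add_ncard_compl S
  have hU' := Set.ncard_add_ncard_compl (insert (v : V) S)
  have hU := hmax (insert (v : V) S)
  simp only [Nat.odd_iff] at hpS hpU
  lia
end

section
/- Let G be a finite 3-edge-connected cubic simple graph, let a be a vertex of G, and let b and c be two distinct neighbors of a. Let E_a be the set of edges incident with b or with c, other than the edges ab and ac. Then G − E_a is connected and has no perfect matching (so E_a is an anti-Kekulé set of G of size at most 4). -/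
open SimpleGraph

/-- If deleting any two edges of `G` leaves it connected, then every finite set of edges that
contains all edges leaving a nontrivial vertex set `X` has at least three elements. -/
theorem three_le_card_of_edge_cut {V : Type*} (G : SimpleGraph V)
    (h3ec : ∀ S : Finset (Sym2 V), S.card ≤ 2 → (G.deleteEdges ↑S).Connected)
    {X : Set V} {x y : V} (hx : x ∈ X) (hy : y ∉ X) (S : Finset (Sym2 V))
    (hS : ∀ u v, G.Adj u v → u ∈ X → v ∉ X → s(u, v) ∈ S) : 3 ≤ S.card := by
  by_contra! hlt
  obtain ⟨p⟩ := (h3ec S (by omega)).preconnected x y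
  obtain ⟨d, -, hdX, hdY⟩ := p.exists_boundary_dart X hx hy
  have hd := d.adj
  rw [deleteEdges_adj] at hd
  exact hd.2 (hS _ _ hd.1 hdX hdY)

/-- In a graph in which `a` has degree three, two distinct neighbors of `a` determine the third. -/
theorem exists_third_neighbor {V : Type*} [Fintype V] [DecidableEq V]
    (G : SimpleGraph V) [DecidableRel G.Adj] {a b c : V} (ha : G.degree a = 3)
    (hab : G.Adj a b) (hac : G.Adj a c) (hbc : b ≠ c) :
    ∃ d, G.Adj a d ∧ d ≠ b ∧ d ≠ c ∧ ∀ v, G.Adj a v → v = b ∨ v = c ∨ v = d := by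
  have h1 : (((G.neighborFinset a).erase b).erase c).card = 1 := by
    rw [Finset.card_erase_of_mem (by simp [hac, hbc.symm]),
      Finset.card_erase_of_mem (by simp [hab]), card_neighborFinset_eq_degree, ha]
  obtain ⟨d, hd⟩ := Finset.card_eq_one.mp h1
  have hmem : ∀ v, (v ≠ c ∧ v ≠ b ∧ G.Adj a v) ↔ v = d := fun v => by
    simpa using Finset.ext_iff.mp hd v
  obtain ⟨hdc, hdb, had⟩ := (hmem d).mpr rfl
  refine ⟨d, had, hdb, hdc, fun v hv => ?_⟩
  have := (hmem v).mp
  tauto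

/-- Let `G` be a finite 3-edge-connected cubic graph, `a` a vertex, and `b, c` two distinct
neighbors of `a`. Let `E_a` be the set of edges incident with `b` or `c` other than `ab`
and `ac`. Then `G - E_a` is connected and has no perfect matching. -/
theorem three_edge_connected_cubic_antiKekule {V : Type*} [Fintype V] [DecidableEq V]
    (G : SimpleGraph V) [DecidableRel G.Adj]
    (h3ec : ∀ S : Finset (Sym2 V), S.card ≤ 2 → (G.deleteEdges ↑S).Connected)
    (hcubic : ∀ v : V, G.degree v = 3)
    (a b c : V) (hab : G.Adj a b) (hac : G.Adj a c) (hbc : b ≠ c)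
    (Ea : Set (Sym2 V))
    (hEa : Ea = {e ∈ G.edgeSet | (b ∈ e ∨ c ∈ e) ∧ e ≠ s(a, b) ∧ e ≠ s(a, c)}) :
    (G.deleteEdges Ea).Connected ∧
      ¬ ∃ M : (G.deleteEdges Ea).Subgraph, M.IsPerfectMatching := by
  have hE : ∀ u v, s(u, v) ∈ Ea ↔ G.Adj u v ∧ ((b = u ∨ b = v) ∨ (c = u ∨ c = v)) ∧
      s(u, v) ≠ s(a, b) ∧ s(u, v) ≠ s(a, c) := fun u v => by
    simp [hEa]
    tauto
  have hab' := hab.ne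
  have hac' := hac.ne
  obtain ⟨d, had, hdb, hdc, hd⟩ := exists_third_neighbor G (hcubic a) hab hac hbc
  constructor
  · have hHa : ∀ v, G.Adj a v → (G.deleteEdges Ea).Adj a v := by
      intro v hv
      rw [deleteEdges_adj, hE]
      refine ⟨hv, ?_⟩
      rintro ⟨-, (rfl | rfl) | (rfl | rfl), h1, h2⟩ <;> simp_all
    have : Nonempty V := ⟨a⟩
    rw [connected_iff_exists_forall_reachable]
    refine ⟨a, ?_⟩
    by_contra! hcon
    obtain ⟨x, hx⟩ := hcon
    classical
    let X : Set V := {v | ¬ (G.deleteEdges Ea).Reachable a v}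
    have hreach : ∀ v, G.Adj a v → v ∉ X := fun v hv => by
      simpa [X] using (hHa v hv).reachable
    have haX : a ∉ X := by simp [X]
    have hbX := hreach b hab
    have hcX := hreach c hac
    have hdX := hreach d had
    have hcross : ∀ u v, G.Adj u v → u ∈ X → v ∉ X → s(u, v) ∈ Ea := by
      intro u v huv hu hv
      by_contra hne
      have hadj : (G.deleteEdges Ea).Adj v u := by
        rw [adj_comm, deleteEdges_adj]
        exact ⟨huv, hne⟩
      simp only [X, Set.mem_ofPred_eq, not_not] at hu hv
      exact hu (hv.trans hadj.reachable)
    let F : Finset (Sym2 V) :=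
      (G.incidenceFinset b).erase s(a, b) ∪ (G.incidenceFinset c).erase s(a, c)
    have hF : F.card ≤ 4 := by
      refine (Finset.card_union_le _ _).trans ?_
      rw [Finset.card_erase_of_mem, Finset.card_erase_of_mem, card_incidenceFinset_eq_degree,
        card_incidenceFinset_eq_degree, hcubic, hcubic]
      · simp [mem_incidenceFinset, mk'_mem_incidenceSet_iff, hac]
      · simp [mem_incidenceFinset, mk'_mem_incidenceSet_iff, hab]
    have hEF : ∀ u v, s(u, v) ∈ Ea → s(u, v) ∈ F := by
      intro u v h
      rw [hE] at h
      simp only [F, Finset.mem_union, Finset.mem_erase, mem_incidenceFinset,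
        mk'_mem_incidenceSet_iff]
      tauto
    have h1 : 3 ≤ (F.filter fun e => ∃ v ∈ e, v ∈ X).card := by
      refine three_le_card_of_edge_cut G h3ec (X := X) hx haX _ fun u v huv hu hv => ?_
      exact Finset.mem_filter.mpr ⟨hEF _ _ (hcross u v huv hu hv), u, by simp, hu⟩
    have h2 : 3 ≤ (insert s(d, a) (F.filter fun e => ¬ ∃ v ∈ e, v ∈ X)).card := by
      refine three_le_card_of_edge_cut G h3ec (X := {v | v ∉ X ∧ v ≠ a ∧ v ≠ b ∧ v ≠ c})
        (x := d) (y := a) ⟨hdX, had.ne', hdb, hdc⟩ (by simp) _ ?_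
      rintro u v huv ⟨huX, hua, hub, huc⟩ hv
      have hvX : v ∉ X := fun hvX => by
        have := (hE _ _).mp (hcross v u huv.symm hvX huX)
        have hvb : b ≠ v := fun h => hbX (h ▸ hvX)
        have hvc : c ≠ v := fun h => hcX (h ▸ hvX)
        have := hub.symm
        have := huc.symm
        tauto
      by_cases hva : v = a
      · subst hva
        rcases hd u huv.symm with h | h | h
        · exact absurd h hub
        · exact absurd h huc
        · simp [h]
      · have hvbc : v = b ∨ v = c := by
          by_contra! h
          exact hv ⟨hvX, hva, h.1, h.2⟩
        refine Finset.mem_insert_of_mem (Finset.mem_filter.mpr ⟨hEF _ _ ?_, by simp [huX, hvX]⟩)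
        rw [hE]
        refine ⟨huv, ?_, ?_, ?_⟩
        · tauto
        · simp [hua, hva]
        · simp [hua, hva]
    have h3 := Finset.card_filter_add_card_filter_not (s := F) (fun e => ∃ v ∈ e, v ∈ X)
    have h4 := Finset.card_insert_le s(d, a) (F.filter fun e => ¬ ∃ v ∈ e, v ∈ X)
    omega
  · rintro ⟨M, hM⟩
    rw [Subgraph.isPerfectMatching_iff] at hM
    have hMb : M.Adj a b := by
      obtain ⟨w, hw, -⟩ := hM b
      have hw' := hw.adj_sub
      rw [deleteEdges_adj, hE] at hw'
      have hwa : w = a := by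
        by_contra hwa
        exact hw'.2 ⟨hw'.1, by simp, by simp [hab'.symm, hwa], by simp [hab'.symm, hwa]⟩
      exact hwa ▸ hw.symm
    have hMc : M.Adj a c := by
      obtain ⟨w, hw, -⟩ := hM c
      have hw' := hw.adj_sub
      rw [deleteEdges_adj, hE] at hw'
      have hwa : w = a := by
        by_contra hwa
        exact hw'.2 ⟨hw'.1, by simp, by simp [hac'.symm, hwa], by simp [hac'.symm, hwa]⟩
      exact hwa ▸ hw.symm
    exact hbc ((hM a).unique hMb hMc)
end
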